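/- arXiv:0910.2531 — 3 statements merged into one kernel-verified Lean document; each statement's English description precedes it below -/
import Mathlib

section
/- With the 2×2 matrix kernels K̃_{r,r}, K̃_{r,c}, K̃_{c,r} defined below, for all real x and y one has ∫_{−∞}^{∞} K̃_{r,r}(x,u)·K̃_{r,r}(u,y) du + 2·∫_{ℝ₊²} K̃_{r,c}(x,z)·K̃_{c,r}(z,y) d²z = K̃_{r,r}(x,y)·[[0,0],[0,1]] + [[1,0],[0,0]]·K̃_{r,r}(x,y), where ℝ₊² denotes the open upper half-plane {X + iY : X ∈ ℝ, Y > 0} and d²z = dX dY. -/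
open MeasureTheory Real Matrix

/-- The complementary error function `erfc s = (2/√π) ∫_s^∞ e^{-t²} dt`. -/
noncomputable def erfc (s : ℝ) : ℝ := (2 / Real.sqrt π) * ∫ t in Set.Ioi s, Real.exp (-t ^ 2)

/-- The real-real block of the bulk-scaled real Ginibre correlation kernel. -/
noncomputable def Krr (x y : ℝ) : Matrix (Fin 2) (Fin 2) ℂ :=
  !![(((y - x) * Real.exp (-(x - y) ^ 2 / 2) / Real.sqrt (2 * π) : ℝ) : ℂ),
     ((Real.exp (-(x - y) ^ 2 / 2) / Real.sqrt (2 * π) : ℝ) : ℂ);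
     ((-(Real.exp (-(x - y) ^ 2 / 2) / Real.sqrt (2 * π)) : ℝ) : ℂ),
     (((1 / 2) * Real.sign (x - y) * erfc (|x - y| / Real.sqrt 2) : ℝ) : ℂ)]

/-- The real-complex block of the bulk-scaled real Ginibre correlation kernel. -/
noncomputable def Krc (x : ℝ) (w : ℂ) : Matrix (Fin 2) (Fin 2) ℂ :=
  ((1 / Real.sqrt (2 * π) * Real.sqrt (erfc (Real.sqrt 2 * w.im)) : ℝ) : ℂ) •
    !![(w - (x : ℂ)) * Complex.exp (-((x : ℂ) - w) ^ 2 / 2),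
       Complex.I * ((starRingEnd ℂ) w - (x : ℂ)) *
         Complex.exp (-((x : ℂ) - (starRingEnd ℂ) w) ^ 2 / 2);
       -Complex.exp (-((x : ℂ) - w) ^ 2 / 2),
       -Complex.I * Complex.exp (-((x : ℂ) - (starRingEnd ℂ) w) ^ 2 / 2)]

/-- The complex-complex block of the bulk-scaled real Ginibre correlation kernel. -/
noncomputable def Kcc (w z : ℂ) : Matrix (Fin 2) (Fin 2) ℂ :=
  ((1 / Real.sqrt (2 * π) *
      Real.sqrt (erfc (Real.sqrt 2 * w.im) * erfc (Real.sqrt 2 * z.im)) : ℝ) : ℂ) •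
    !![(z - w) * Complex.exp (-(w - z) ^ 2 / 2),
       Complex.I * ((starRingEnd ℂ) z - w) * Complex.exp (-(w - (starRingEnd ℂ) z) ^ 2 / 2);
       Complex.I * (z - (starRingEnd ℂ) w) * Complex.exp (-((starRingEnd ℂ) w - z) ^ 2 / 2),
       -((starRingEnd ℂ) z - (starRingEnd ℂ) w) *
         Complex.exp (-((starRingEnd ℂ) w - (starRingEnd ℂ) z) ^ 2 / 2)]

/-- The complex-real block of the bulk-scaled real Ginibre correlation kernel,
`K_{c,r}(z,x) = -(K_{r,c}(x,z))ᵀ`. -/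
noncomputable def Kcr (z : ℂ) (x : ℝ) : Matrix (Fin 2) (Fin 2) ℂ := -(Krc x z)ᵀ

/-- `J = [[0,-1],[1,0]]`. -/
noncomputable def J2 : Matrix (Fin 2) (Fin 2) ℂ := !![0, -1; 1, 0]

/-- Tilded kernel `K̃_{r,r}(x,y) = K_{r,r}(x,y) J`. -/
noncomputable def Ktrr (x y : ℝ) : Matrix (Fin 2) (Fin 2) ℂ := Krr x y * J2

/-- Tilded kernel `K̃_{r,c}(x,w) = K_{r,c}(x,w) J`. -/
noncomputable def Ktrc (x : ℝ) (w : ℂ) : Matrix (Fin 2) (Fin 2) ℂ := Krc x w * J2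

/-- Tilded kernel `K̃_{c,r}(z,x) = K_{c,r}(z,x) J`. -/
noncomputable def Ktcr (z : ℂ) (x : ℝ) : Matrix (Fin 2) (Fin 2) ℂ := Kcr z x * J2

/-- Tilded kernel `K̃_{c,c}(w,z) = K_{c,c}(w,z) J`. -/
noncomputable def Ktcc (w z : ℂ) : Matrix (Fin 2) (Fin 2) ℂ := Kcc w z * J2

attribute [local instance] Matrix.normedAddCommGroup Matrix.normedSpace

lemma integrable_exp_neg_sq : Integrable fun t : ℝ => Real.exp (-t ^ 2) := by
  simpa using integrable_exp_neg_mul_sq one_pos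

lemma hasDerivAt_exp_neg_sq (t : ℝ) :
    HasDerivAt (fun t : ℝ => Real.exp (-t ^ 2)) (Real.exp (-t ^ 2) * (-(2 * t))) t := by
  simpa using (hasDerivAt_pow 2 t).neg.exp

lemma hasDerivAt_erfc (s : ℝ) :
    HasDerivAt erfc (-(2 / √π * Real.exp (-s ^ 2))) s := by
  have hint := integrable_exp_neg_sq
  have hcont : Continuous fun t : ℝ => Real.exp (-t ^ 2) := by fun_prop
  have key : ∀ s, erfc s = 2 / √π * ((∫ t in Set.Ioi 0, Real.exp (-t ^ 2)) -
      ∫ t in (0 : ℝ)..s, Real.exp (-t ^ 2)) := by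
    intro s
    rw [erfc, ← intervalIntegral.integral_Ioi_sub_Ioi' hint.integrableOn hint.integrableOn]
    ring
  rw [funext key]
  have h := (hcont.integral_hasStrictDerivAt 0 s).hasDerivAt
  exact ((h.const_sub (∫ t in Set.Ioi 0, Real.exp (-t ^ 2))).const_mul (2 / √π)).congr_deriv
    (mul_neg _ _)

lemma continuous_erfc : Continuous erfc :=
  continuous_iff_continuousAt.2 fun s => (hasDerivAt_erfc s).continuousAt

lemma integral_Ioi_exp_neg_sq : ∫ t in Set.Ioi (0 : ℝ), Real.exp (-t ^ 2) = √π / 2 := by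
  simpa using integral_gaussian_Ioi 1

lemma erfc_zero : erfc 0 = 1 := by
  have : √π ≠ 0 := by positivity
  rw [erfc, integral_Ioi_exp_neg_sq]
  field_simp

lemma erfc_nonneg (s : ℝ) : 0 ≤ erfc s :=
  mul_nonneg (by positivity) (integral_nonneg fun _ => by positivity)

lemma erfc_le_exp_neg_sq {s : ℝ} (hs : 0 ≤ s) : erfc s ≤ Real.exp (-s ^ 2) := by
  have hint := integrable_exp_neg_sq
  have hshift : ∫ t in Set.Ioi s, Real.exp (-t ^ 2) =
      ∫ t in Set.Ioi (0 : ℝ), Real.exp (-(t + s) ^ 2) := by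
    simpa using ((measurePreserving_add_right volume s).setIntegral_preimage_emb
      (measurableEmbedding_addRight s) (fun t : ℝ => Real.exp (-t ^ 2)) (Set.Ioi s)).symm
  have hle : ∫ t in Set.Ioi (0 : ℝ), Real.exp (-(t + s) ^ 2) ≤
      ∫ t in Set.Ioi (0 : ℝ), Real.exp (-s ^ 2) * Real.exp (-t ^ 2) := by
    refine setIntegral_mono_on (hint.comp_add_right s).integrableOn
      (hint.const_mul _).integrableOn measurableSet_Ioi fun t ht => ?_
    rw [← Real.exp_add, Real.exp_le_exp]
    nlinarith [mul_nonneg (le_of_lt (Set.mem_Ioi.1 ht)) hs]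
  rw [integral_const_mul, integral_Ioi_exp_neg_sq] at hle
  have hpi : 0 < √π := by positivity
  rw [erfc, hshift]
  calc _ ≤ 2 / √π * (Real.exp (-s ^ 2) * (√π / 2)) := by gcongr
    _ = _ := by field_simp

lemma integral_Ioi_eq_neg_of_hasDerivAt {f f' : ℝ → ℝ} (h : ∀ t, HasDerivAt f (f' t) t)
    (hf' : IntegrableOn f' (Set.Ioi 0)) (hf : IntegrableOn f (Set.Ioi 0)) :
    ∫ t in Set.Ioi 0, f' t = -f 0 := by
  rw [integral_Ioi_of_hasDerivAt_of_tendsto' (fun t _ => h t) hf'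
    (tendsto_zero_of_hasDerivAt_of_integrableOn_Ioi (fun t _ => h t) hf' hf), zero_sub]

lemma integrable_exp_neg_sq_mul {P : ℝ → ℝ} (hP : Continuous P) {C : ℝ}
    (hC : ∀ t, |P t| ≤ C * (1 + t ^ 2)) :
    Integrable fun t => Real.exp (-t ^ 2) * P t := by
  have hdom : Integrable fun t : ℝ => C * (2 * Real.exp (-(1 / 2) * t ^ 2)) :=
    ((integrable_exp_neg_mul_sq (by norm_num)).const_mul 2).const_mul C
  have hC0 : 0 ≤ C := by simpa using (abs_nonneg _).trans (hC 0)
  refine hdom.mono' (by fun_prop) (.of_forall fun t => ?_)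
  have h1 : 1 + t ^ 2 ≤ 2 * Real.exp (t ^ 2 / 2) := by
    linarith [Real.add_one_le_exp (t ^ 2 / 2)]
  rw [norm_mul, Real.norm_eq_abs, Real.norm_eq_abs, abs_of_pos (Real.exp_pos _)]
  calc Real.exp (-t ^ 2) * |P t| ≤ Real.exp (-t ^ 2) * (C * (2 * Real.exp (t ^ 2 / 2))) := by
        gcongr
        exact (hC t).trans (by gcongr)
    _ = C * (2 * (Real.exp (-t ^ 2) * Real.exp (t ^ 2 / 2))) := by ring
    _ = _ := by rw [← Real.exp_add]; ring_nf

/-- The product `erfc (√2 Y) e^{Y²}`, the weight in the imaginary direction of the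
real-complex kernel. -/
noncomputable def erfcWeight (Y : ℝ) : ℝ := erfc (√2 * Y) * Real.exp (Y ^ 2)

lemma erfcWeight_nonneg (Y : ℝ) : 0 ≤ erfcWeight Y :=
  mul_nonneg (erfc_nonneg _) (Real.exp_pos _).le

lemma erfcWeight_le {Y : ℝ} (hY : 0 ≤ Y) : erfcWeight Y ≤ Real.exp (-Y ^ 2) := by
  calc erfcWeight Y ≤ Real.exp (-(√2 * Y) ^ 2) * Real.exp (Y ^ 2) := by
        unfold erfcWeight
        gcongr
        exact erfc_le_exp_neg_sq (by positivity)
    _ = _ := by rw [← Real.exp_add, mul_pow, Real.sq_sqrt zero_le_two]; ring_nf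

lemma continuous_erfcWeight : Continuous erfcWeight := by
  have := continuous_erfc
  unfold erfcWeight
  fun_prop

lemma erfcWeight_zero : erfcWeight 0 = 1 := by simp [erfcWeight, erfc_zero]

lemma hasDerivAt_erfcWeight (Y : ℝ) :
    HasDerivAt erfcWeight (2 * Y * erfcWeight Y - 2 * √2 / √π * Real.exp (-Y ^ 2)) Y := by
  have h1 : HasDerivAt (fun Y : ℝ => √2 * Y) √2 Y := by
    simpa using (hasDerivAt_id Y).const_mul √2
  have h2 : HasDerivAt (fun Y : ℝ => Real.exp (Y ^ 2)) (Real.exp (Y ^ 2) * (2 * Y)) Y := by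
    simpa using (hasDerivAt_pow 2 Y).exp
  refine (((hasDerivAt_erfc _).comp Y h1).mul h2).congr_deriv ?_
  have : Real.exp (-(√2 * Y) ^ 2) * Real.exp (Y ^ 2) = Real.exp (-Y ^ 2) := by
    rw [← Real.exp_add, mul_pow, Real.sq_sqrt zero_le_two]; ring_nf
  simp only [erfcWeight, Function.comp, ← this]
  ring

lemma integrableOn_erfcWeight_mul {P : ℝ → ℝ} (hP : Continuous P) {C : ℝ}
    (hC : ∀ t, |P t| ≤ C * (1 + t ^ 2)) :
    IntegrableOn (fun t => erfcWeight t * P t) (Set.Ioi 0) := by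
  have := continuous_erfcWeight
  refine (integrable_exp_neg_sq_mul hP hC).norm.integrableOn.mono' (by fun_prop)
    ((ae_restrict_mem measurableSet_Ioi).mono fun t ht => ?_)
  rw [norm_mul, norm_mul, Real.norm_of_nonneg (erfcWeight_nonneg t),
    Real.norm_of_nonneg (Real.exp_pos _).le]
  gcongr
  exact erfcWeight_le (le_of_lt ht)

lemma integral_Ioi_exp_neg_sq_mul_cos (d : ℝ) :
    ∫ t in Set.Ioi (0 : ℝ), Real.exp (-t ^ 2) * Real.cos (t * d) =
      √π / 2 * Real.exp (-d ^ 2 / 4) := by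
  have h1 := integral_comp_abs (f := fun t : ℝ => Real.exp (-t ^ 2) * Real.cos (t * d))
  have h2 : ∀ t : ℝ, Real.cos (|t| * d) = Real.cos (t * d) := by
    intro t
    rcases abs_choice t with h | h <;> simp [h]
  simp only [sq_abs, h2] at h1
  have h3 := congrArg Complex.re (fourierIntegral_gaussian (b := 1) (by simp) (d : ℂ))
  have hint : Integrable fun t : ℝ =>
      Complex.exp (Complex.I * d * t) * Complex.exp (-1 * (t : ℂ) ^ 2) := by
    refine (integrable_exp_neg_mul_sq one_pos).mono' (by fun_prop) (.of_forall fun t => ?_)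
    rw [norm_mul, Complex.norm_exp, Complex.norm_exp]
    simp [← Complex.ofReal_pow]
  rw [← RCLike.re_eq_complex_re, ← integral_re hint] at h3
  have h4 : ∀ t : ℝ, RCLike.re (Complex.exp (Complex.I * d * t) *
      Complex.exp (-1 * (t : ℂ) ^ 2)) = Real.exp (-t ^ 2) * Real.cos (t * d) := by
    intro t
    rw [← Complex.exp_add, RCLike.re_eq_complex_re, Complex.exp_re]
    simp [← Complex.ofReal_pow, mul_comm]
  have h5 : ((π : ℂ) / 1) ^ (1 / 2 : ℂ) * Complex.exp (-(d : ℂ) ^ 2 / (4 * 1)) =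
      ((√π * Real.exp (-d ^ 2 / 4) : ℝ) : ℂ) := by
    rw [Real.sqrt_eq_rpow, Complex.ofReal_mul, Complex.ofReal_cpow pi_pos.le]
    push_cast
    simp
  simp only [h4] at h3
  rw [h5, RCLike.re_eq_complex_re, Complex.ofReal_re] at h3
  linarith

lemma abs_mul_sin_add_mul_cos_le (a b θ : ℝ) :
    |a * Real.sin θ + b * Real.cos θ| ≤ |a| + |b| := by
  refine (abs_add_le _ _).trans ?_
  rw [abs_mul, abs_mul]
  exact add_le_add (mul_le_of_le_one_right (abs_nonneg _) (Real.abs_sin_le_one _))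
    (mul_le_of_le_one_right (abs_nonneg _) (Real.abs_cos_le_one _))

lemma abs_le_one_add_sq (t : ℝ) : |t| ≤ 1 + t ^ 2 := by
  rw [← sq_abs]
  nlinarith [sq_nonneg (|t| - 1), abs_nonneg t]

lemma integrable_exp_neg_sq_mul_cos (d : ℝ) :
    Integrable fun t : ℝ => Real.exp (-t ^ 2) * Real.cos (t * d) :=
  integrable_exp_neg_sq_mul (by fun_prop) (C := 1) fun t => by
    nlinarith [Real.abs_cos_le_one (t * d)]

lemma integrable_exp_neg_sq_mul_sin (d : ℝ) :
    Integrable fun t : ℝ => Real.exp (-t ^ 2) * Real.sin (t * d) :=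
  integrable_exp_neg_sq_mul (by fun_prop) (C := 1) fun t => by
    nlinarith [Real.abs_sin_le_one (t * d)]

lemma integrableOn_erfcWeight_mul_sin (d : ℝ) :
    IntegrableOn (fun Y => erfcWeight Y * Real.sin (Y * d)) (Set.Ioi 0) :=
  integrableOn_erfcWeight_mul (by fun_prop) (C := 1) fun t => by
    nlinarith [Real.abs_sin_le_one (t * d)]

lemma hasDerivAt_cos_mul_const (d t : ℝ) :
    HasDerivAt (fun t => Real.cos (t * d)) (-(d * Real.sin (t * d))) t :=
  ((hasDerivAt_id' t).mul_const d).cos.congr_deriv (by ring)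

lemma hasDerivAt_sin_mul_const (d t : ℝ) :
    HasDerivAt (fun t => Real.sin (t * d)) (d * Real.cos (t * d)) t :=
  ((hasDerivAt_id' t).mul_const d).sin.congr_deriv (by ring)

lemma integrableOn_erfcWeight_linear (d : ℝ) :
    IntegrableOn (fun Y => erfcWeight Y *
      (-(d / 2) * Real.sin (Y * d) + Y * Real.cos (Y * d))) (Set.Ioi 0) := by
  refine integrableOn_erfcWeight_mul (by fun_prop) (C := |d / 2| + 1) fun t => ?_
  refine (abs_mul_sin_add_mul_cos_le _ _ _).trans ?_
  rw [abs_neg]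
  nlinarith [abs_le_one_add_sq t, mul_nonneg (abs_nonneg (d / 2)) (sq_nonneg t)]

lemma integral_erfcWeight_linear (d : ℝ) :
    ∫ Y in Set.Ioi 0, erfcWeight Y * (-(d / 2) * Real.sin (Y * d) + Y * Real.cos (Y * d)) =
      -1 / 2 + √2 / 2 * Real.exp (-d ^ 2 / 4) := by
  have hP := integrableOn_erfcWeight_linear d
  have hcos := ((integrable_exp_neg_sq_mul_cos d).const_mul (√2 / √π)).integrableOn
    (s := Set.Ioi 0)
  have hint : IntegrableOn (fun Y => erfcWeight Y * (Real.cos (Y * d) / 2)) (Set.Ioi 0) :=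
    integrableOn_erfcWeight_mul (by fun_prop) (C := 1) fun t => by
      rw [abs_div, abs_two]
      nlinarith [Real.abs_cos_le_one (t * d)]
  have h := integral_Ioi_eq_neg_of_hasDerivAt (fun t => ((hasDerivAt_erfcWeight t).mul
    ((hasDerivAt_cos_mul_const d t).div_const 2)).congr_deriv (g' := erfcWeight t *
      (-(d / 2) * Real.sin (t * d) + t * Real.cos (t * d)) -
      √2 / √π * (Real.exp (-t ^ 2) * Real.cos (t * d))) (by ring)) (hP.sub hcos) hint
  rw [integral_sub hP hcos, integral_const_mul, integral_Ioi_exp_neg_sq_mul_cos] at h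
  have hpi : √π ≠ 0 := by positivity
  have : √2 / √π * (√π / 2 * Real.exp (-d ^ 2 / 4)) = √2 / 2 * Real.exp (-d ^ 2 / 4) := by
    field_simp
  simp [erfcWeight_zero, this, -neg_mul] at h
  linarith

lemma integrableOn_erfcWeight_quadratic (c d : ℝ) :
    IntegrableOn (fun Y => erfcWeight Y *
      ((c + Y ^ 2 - d ^ 2 / 4) * Real.sin (Y * d) + Y * d * Real.cos (Y * d)))
      (Set.Ioi 0) := by
  refine integrableOn_erfcWeight_mul (by fun_prop) (C := |c - d ^ 2 / 4| + |d| + 1) fun t => ?_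
  refine (abs_mul_sin_add_mul_cos_le _ _ _).trans ?_
  have h1 : |c + t ^ 2 - d ^ 2 / 4| ≤ |c - d ^ 2 / 4| + t ^ 2 := by
    have := abs_add_le (c - d ^ 2 / 4) (t ^ 2)
    rwa [abs_of_nonneg (sq_nonneg t), sub_add_eq_add_sub] at this
  rw [abs_mul]
  nlinarith [mul_le_mul_of_nonneg_right (abs_le_one_add_sq t) (abs_nonneg d),
    mul_nonneg (abs_nonneg (c - d ^ 2 / 4)) (sq_nonneg t)]

lemma integral_erfcWeight_quadratic (d : ℝ) :
    ∫ Y in Set.Ioi 0, erfcWeight Y *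
      ((1 / 2 + Y ^ 2 - d ^ 2 / 4) * Real.sin (Y * d) + Y * d * Real.cos (Y * d)) =
      d * (-1 / 4 + √2 / 2 * Real.exp (-d ^ 2 / 4)) := by
  have hP := integrableOn_erfcWeight_quadratic (1 / 2) d
  have hcos := ((integrable_exp_neg_sq_mul_cos d).const_mul (d * √2 / √π)).integrableOn
    (s := Set.Ioi 0)
  have hint1 : IntegrableOn (fun Y => erfcWeight Y *
      (Y / 2 * Real.sin (Y * d) + d / 4 * Real.cos (Y * d))) (Set.Ioi 0) := by
    refine integrableOn_erfcWeight_mul (by fun_prop) (C := 1 + |d / 4|) fun t => ?_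
    refine (abs_mul_sin_add_mul_cos_le _ _ _).trans ?_
    rw [abs_div, abs_two]
    nlinarith [abs_le_one_add_sq t, mul_nonneg (abs_nonneg (d / 4)) (sq_nonneg t),
      abs_nonneg t]
  have hint2 := ((integrable_exp_neg_sq_mul_sin d).const_mul (√2 / √π / 2)).integrableOn
    (s := Set.Ioi 0)
  have h := integral_Ioi_eq_neg_of_hasDerivAt (fun t => (((hasDerivAt_erfcWeight t).mul
    ((((hasDerivAt_id t).div_const 2).mul (hasDerivAt_sin_mul_const d t)).add
      ((hasDerivAt_cos_mul_const d t).const_mul (d / 4)))).sub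
    (((hasDerivAt_exp_neg_sq t).mul (hasDerivAt_sin_mul_const d t)).const_mul
      (√2 / √π / 2))).congr_deriv (g' := erfcWeight t *
      ((1 / 2 + t ^ 2 - d ^ 2 / 4) * Real.sin (t * d) + t * d * Real.cos (t * d)) -
      d * √2 / √π * (Real.exp (-t ^ 2) * Real.cos (t * d))) (by simp; ring))
      (hP.sub hcos) (hint1.sub hint2)
  rw [integral_sub hP hcos, integral_const_mul, integral_Ioi_exp_neg_sq_mul_cos] at h
  have hpi : √π ≠ 0 := by positivity
  have : d * √2 / √π * (√π / 2 * Real.exp (-d ^ 2 / 4)) =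
      d * √2 / 2 * Real.exp (-d ^ 2 / 4) := by
    field_simp
  simp [erfcWeight_zero, this] at h
  linarith

lemma hasDerivAt_exp_mul_integral_erfcWeight_sin (d : ℝ) :
    HasDerivAt (fun d => Real.exp (-d ^ 2 / 4) *
        ∫ Y in Set.Ioi 0, erfcWeight Y * Real.sin (Y * d))
      (Real.exp (-d ^ 2 / 4) * (-1 / 2 + √2 / 2 * Real.exp (-d ^ 2 / 4))) d := by
  have hw := continuous_erfcWeight
  have hS := integrableOn_erfcWeight_mul_sin d
  have hbound : IntegrableOn (fun Y => erfcWeight Y * |Y|) (Set.Ioi 0) :=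
    integrableOn_erfcWeight_mul (by fun_prop) (C := 1) fun t => by
      simpa using abs_le_one_add_sq t
  obtain ⟨hC, hderiv⟩ := hasDerivAt_integral_of_dominated_loc_of_deriv_le
    (μ := volume.restrict (Set.Ioi 0))
    (F := fun d Y => erfcWeight Y * Real.sin (Y * d))
    (F' := fun d Y => erfcWeight Y * (Y * Real.cos (Y * d))) (x₀ := d) Filter.univ_mem
    (.of_forall fun d => by fun_prop) hS (by fun_prop)
    (.of_forall fun Y d _ => by
      rw [norm_mul, norm_mul, Real.norm_of_nonneg (erfcWeight_nonneg Y)]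
      exact mul_le_mul_of_nonneg_left (mul_le_of_le_one_right (abs_nonneg _)
        (Real.abs_cos_le_one _)) (erfcWeight_nonneg Y)) hbound
    (.of_forall fun Y d _ => by
      simpa only [mul_comm Y] using (hasDerivAt_sin_mul_const Y d).const_mul (erfcWeight Y))
  have hexp : HasDerivAt (fun d : ℝ => Real.exp (-d ^ 2 / 4))
      (Real.exp (-d ^ 2 / 4) * (-(2 * d) / 4)) d := by
    simpa using ((hasDerivAt_pow 2 d).neg.div_const 4).exp
  refine (hexp.mul hderiv).congr_deriv ?_
  have hlin := integral_erfcWeight_linear d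
  have : ∫ Y in Set.Ioi 0, erfcWeight Y * (-(d / 2) * Real.sin (Y * d) + Y * Real.cos (Y * d)) =
      -(d / 2) * (∫ Y in Set.Ioi 0, erfcWeight Y * Real.sin (Y * d)) +
        ∫ Y in Set.Ioi 0, erfcWeight Y * (Y * Real.cos (Y * d)) := by
    rw [← integral_const_mul, ← integral_add (hS.const_mul _) hC]
    congr 1 with Y
    ring
  rw [this] at hlin
  rw [← hlin]
  ring

/-- The standard Gaussian density. -/
noncomputable def gaussDensity (s : ℝ) : ℝ := Real.exp (-s ^ 2 / 2) / √(2 * π)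

/-- The odd function `sgn(s) erfc(|s|/√2) / 2` in the lower right entry of the real-real kernel. -/
noncomputable def signErfc (s : ℝ) : ℝ := 1 / 2 * Real.sign s * erfc (|s| / √2)

lemma gaussDensity_eq (s : ℝ) :
    gaussDensity s = Real.exp (-s ^ 2 / 4) ^ 2 * √2 / (2 * √π) := by
  have h : Real.exp (-s ^ 2 / 2) = Real.exp (-s ^ 2 / 4) ^ 2 := by
    rw [← Real.exp_nat_mul]
    ring_nf
  have h2 : √2 * √2 = 2 := Real.mul_self_sqrt zero_le_two
  rw [gaussDensity, h, Real.sqrt_mul zero_le_two]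
  generalize Real.exp (-s ^ 2 / 4) = E
  field_simp
  linear_combination (-E ^ 2) * h2

lemma continuous_gaussDensity : Continuous gaussDensity := by
  unfold gaussDensity
  fun_prop

lemma gaussDensity_neg (s : ℝ) : gaussDensity (-s) = gaussDensity s := by simp [gaussDensity]

lemma hasDerivAt_gaussDensity (s : ℝ) : HasDerivAt gaussDensity (-(s * gaussDensity s)) s := by
  have h : HasDerivAt (fun s : ℝ => Real.exp (-s ^ 2 / 2))
      (Real.exp (-s ^ 2 / 2) * (-(2 * s) / 2)) s := by
    simpa using ((hasDerivAt_pow 2 s).neg.div_const 2).exp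
  refine (h.div_const (√(2 * π))).congr_deriv ?_
  unfold gaussDensity
  ring

lemma integrable_gaussDensity : Integrable gaussDensity := by
  refine ((integrable_exp_neg_mul_sq (b := 1 / 2) (by norm_num)).div_const (√(2 * π))).congr
    (.of_forall fun s => ?_)
  simp only [gaussDensity]
  ring_nf

lemma gaussDensity_nonneg (s : ℝ) : 0 ≤ gaussDensity s := by unfold gaussDensity; positivity

lemma sqrt_two_pi_ge_one : 1 ≤ √(2 * π) := by
  rw [Real.one_le_sqrt]
  linarith [Real.pi_gt_three]

lemma abs_gaussDensity_le_one (s : ℝ) : |gaussDensity s| ≤ 1 := by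
  rw [abs_of_nonneg (gaussDensity_nonneg s), gaussDensity, div_le_one (by positivity)]
  refine le_trans (Real.exp_le_one_iff.2 ?_) sqrt_two_pi_ge_one
  nlinarith [sq_nonneg s]

lemma abs_mul_gaussDensity_le_one (s : ℝ) : |s * gaussDensity s| ≤ 1 := by
  rw [abs_mul, abs_of_nonneg (gaussDensity_nonneg s), gaussDensity, ← mul_div_assoc,
    div_le_one (by positivity)]
  refine le_trans ?_ sqrt_two_pi_ge_one
  have h1 : |s| ≤ Real.exp (s ^ 2 / 2) := by
    have := Real.add_one_le_exp (s ^ 2 / 2)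
    nlinarith [sq_nonneg (|s| - 1), sq_abs s]
  calc |s| * Real.exp (-s ^ 2 / 2) ≤ Real.exp (s ^ 2 / 2) * Real.exp (-s ^ 2 / 2) := by gcongr
    _ = 1 := by rw [← Real.exp_add]; ring_nf; simp

lemma measurable_sign : Measurable Real.sign := by
  unfold Real.sign
  exact Measurable.ite measurableSet_Iio measurable_const
    (Measurable.ite measurableSet_Ioi measurable_const measurable_const)

lemma measurable_signErfc : Measurable signErfc := by
  have h1 := measurable_sign
  have h2 := continuous_erfc.measurable
  unfold signErfc
  fun_prop

lemma signErfc_neg (s : ℝ) : signErfc (-s) = -signErfc s := by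
  simp only [signErfc, Real.sign_neg, abs_neg]
  ring

lemma signErfc_of_pos {s : ℝ} (hs : 0 < s) : signErfc s = erfc (s / √2) / 2 := by
  rw [signErfc, Real.sign_of_pos hs, abs_of_pos hs]
  ring

lemma abs_signErfc_le (s : ℝ) : |signErfc s| ≤ Real.exp (-(1 / 2) * s ^ 2) := by
  have h1 : |Real.sign s| ≤ 1 := by
    rcases Real.sign_apply_eq s with h | h | h <;> simp [h]
  have h2 : erfc (|s| / √2) ≤ Real.exp (-(1 / 2) * s ^ 2) := by
    refine (erfc_le_exp_neg_sq (by positivity)).trans_eq ?_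
    rw [div_pow, sq_abs, Real.sq_sqrt zero_le_two]
    ring_nf
  rw [signErfc, abs_mul, abs_mul, abs_of_nonneg (erfc_nonneg _)]
  have h3 := erfc_nonneg (|s| / √2)
  have : |(1 / 2 : ℝ)| = 1 / 2 := by norm_num
  rw [this]
  nlinarith [mul_le_mul_of_nonneg_right h1 h3]

lemma integrable_signErfc : Integrable signErfc :=
  (integrable_exp_neg_mul_sq (by norm_num)).mono' measurable_signErfc.aestronglyMeasurable
    (.of_forall abs_signErfc_le)

lemma integrable_signErfc_mul_gaussDensity (d : ℝ) :
    Integrable fun s => signErfc s * gaussDensity (d - s) := by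
  have := continuous_gaussDensity
  exact integrable_signErfc.mul_bdd (by fun_prop)
    (.of_forall fun s => abs_gaussDensity_le_one _)

lemma integrable_signErfc_mul_deriv_gaussDensity (d : ℝ) :
    Integrable fun s => signErfc s * ((d - s) * gaussDensity (d - s)) := by
  have := continuous_gaussDensity
  exact integrable_signErfc.mul_bdd (by fun_prop)
    (.of_forall fun s => abs_mul_gaussDensity_le_one _)

lemma integrable_gaussDensity_mul_gaussDensity (d : ℝ) :
    Integrable fun s => gaussDensity s * gaussDensity (d - s) := by
  have := continuous_gaussDensity
  exact integrable_gaussDensity.mul_bdd (by fun_prop)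
    (.of_forall fun s => abs_gaussDensity_le_one _)

lemma integral_gaussDensity_mul_gaussDensity (d : ℝ) :
    ∫ s, gaussDensity s * gaussDensity (d - s) = Real.exp (-d ^ 2 / 4) / (2 * √π) := by
  have h : ∀ s, gaussDensity s * gaussDensity (d - s) =
      Real.exp (-d ^ 2 / 4) / (2 * π) * Real.exp (-1 * (s - d / 2) ^ 2) := by
    intro s
    have h2 : √(2 * π) * √(2 * π) = 2 * π := Real.mul_self_sqrt (by positivity)
    rw [gaussDensity, gaussDensity, div_mul_div_comm, h2, ← Real.exp_add, div_mul_eq_mul_div,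
      ← Real.exp_add]
    ring_nf
  simp only [h]
  rw [integral_const_mul, integral_sub_right_eq_self (fun s : ℝ => Real.exp (-1 * s ^ 2)),
    integral_gaussian, div_one]
  have hpi : √π ≠ 0 := by positivity
  have : π = √π * √π := (Real.mul_self_sqrt pi_pos.le).symm
  nth_rewrite 1 [this]
  field_simp

lemma integral_Ioi_signErfc_mul_deriv_gaussDensity (d : ℝ) :
    ∫ s in Set.Ioi 0, signErfc s * ((d - s) * gaussDensity (d - s)) =
      -(gaussDensity d / 2) + ∫ s in Set.Ioi 0, gaussDensity s * gaussDensity (d - s) := by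
  have hφ := (integrable_gaussDensity_mul_gaussDensity d).integrableOn (s := Set.Ioi 0)
  have hcongr : ∀ g : ℝ → ℝ, Set.EqOn (fun s => signErfc s * g s)
      (fun s => erfc (s / √2) / 2 * g s) (Set.Ioi 0) := fun g s hs => by
    simp only [signErfc_of_pos hs]
  have hψ := ((integrable_signErfc_mul_deriv_gaussDensity d).integrableOn
    (s := Set.Ioi 0)).congr_fun (hcongr _) measurableSet_Ioi
  have hε := ((integrable_signErfc_mul_gaussDensity d).integrableOn
    (s := Set.Ioi 0)).congr_fun (hcongr _) measurableSet_Ioi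
  rw [setIntegral_congr_fun measurableSet_Ioi (hcongr _)]
  have hE : ∀ s, HasDerivAt (fun s => erfc (s / √2) / 2) (-gaussDensity s) s := fun s => by
    refine (((hasDerivAt_erfc _).comp s ((hasDerivAt_id s).div_const √2)).div_const 2).congr_deriv
      ?_
    have : (s / √2) ^ 2 = s ^ 2 / 2 := by rw [div_pow, Real.sq_sqrt zero_le_two]
    simp only [gaussDensity, id, this, Real.sqrt_mul zero_le_two, neg_div]
    field_simp
  have hG : ∀ s, HasDerivAt (fun s => gaussDensity (d - s)) ((d - s) * gaussDensity (d - s)) s :=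
    fun s => ((hasDerivAt_gaussDensity (d - s)).comp s ((hasDerivAt_id s).const_sub d)).congr_deriv
      (by ring)
  have h := integral_Ioi_eq_neg_of_hasDerivAt (fun s => ((hE s).mul (hG s)).congr_deriv
    (g' := erfc (s / √2) / 2 * ((d - s) * gaussDensity (d - s)) -
      gaussDensity s * gaussDensity (d - s)) (by ring)) (hψ.sub hφ) hε
  rw [integral_sub hψ hφ] at h
  simp [erfc_zero] at h
  linarith

lemma integral_eq_integral_Ioi_add_neg {f : ℝ → ℝ} (hf : Integrable f) :
    ∫ s, f s = (∫ s in Set.Ioi 0, f s) + ∫ s in Set.Ioi 0, f (-s) := by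
  rw [integral_comp_neg_Ioi, neg_zero, add_comm, intervalIntegral.integral_Iic_add_Ioi
    hf.integrableOn hf.integrableOn]

lemma integral_signErfc_mul_deriv_gaussDensity (d : ℝ) :
    ∫ s, signErfc s * ((d - s) * gaussDensity (d - s)) =
      Real.exp (-d ^ 2 / 4) / (2 * √π) - gaussDensity d := by
  rw [integral_eq_integral_Ioi_add_neg (integrable_signErfc_mul_deriv_gaussDensity d),
    ← integral_gaussDensity_mul_gaussDensity,
    integral_eq_integral_Ioi_add_neg (integrable_gaussDensity_mul_gaussDensity d)]
  have h1 : ∀ s, signErfc (-s) * ((d - -s) * gaussDensity (d - -s)) =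
      signErfc s * ((-d - s) * gaussDensity (-d - s)) := fun s => by
    rw [signErfc_neg, ← gaussDensity_neg (-d - s)]
    ring_nf
  have h2 : ∀ s, gaussDensity (-s) * gaussDensity (d - -s) =
      gaussDensity s * gaussDensity (-d - s) := fun s => by
    rw [gaussDensity_neg, ← gaussDensity_neg (-d - s)]
    ring_nf
  simp only [h1, h2, integral_Ioi_signErfc_mul_deriv_gaussDensity, gaussDensity_neg d]
  ring

lemma hasDerivAt_integral_signErfc_mul_gaussDensity (d : ℝ) :
    HasDerivAt (fun d => ∫ s, signErfc s * gaussDensity (d - s))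
      (gaussDensity d - Real.exp (-d ^ 2 / 4) / (2 * √π)) d := by
  have hg := continuous_gaussDensity
  have hm := measurable_signErfc
  have h := (hasDerivAt_integral_of_dominated_loc_of_deriv_le
    (F := fun d s => signErfc s * gaussDensity (d - s)) (bound := fun s => |signErfc s|)
    (F' := fun d s => signErfc s * (-((d - s) * gaussDensity (d - s)))) (x₀ := d)
    Filter.univ_mem
    (.of_forall fun d => (integrable_signErfc_mul_gaussDensity d).aestronglyMeasurable)
    (integrable_signErfc_mul_gaussDensity d)
    (by simpa [Pi.neg_def] using
      (integrable_signErfc_mul_deriv_gaussDensity d).aestronglyMeasurable.neg)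
    (.of_forall fun s d _ => by
      rw [norm_mul, norm_neg]
      exact mul_le_of_le_one_right (abs_nonneg _) (abs_mul_gaussDensity_le_one _))
    integrable_signErfc.abs
    (.of_forall fun s d _ =>
      (((hasDerivAt_gaussDensity (d - s)).comp_sub_const d s).const_mul (signErfc s)))).2
  refine h.congr_deriv ?_
  simp only [mul_neg, integral_neg, integral_signErfc_mul_deriv_gaussDensity, neg_sub]

lemma integral_signErfc_mul_gaussDensity (d : ℝ) :
    ∫ s, signErfc s * gaussDensity (d - s) = 1 / √π * (Real.exp (-d ^ 2 / 4) *
      ∫ Y in Set.Ioi 0, erfcWeight Y * Real.sin (Y * d)) := by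
  have hderiv : ∀ d, HasDerivAt (fun d => (∫ s, signErfc s * gaussDensity (d - s)) -
      1 / √π * (Real.exp (-d ^ 2 / 4) *
        ∫ Y in Set.Ioi 0, erfcWeight Y * Real.sin (Y * d))) 0 d := fun d => by
    refine ((hasDerivAt_integral_signErfc_mul_gaussDensity d).sub
      ((hasDerivAt_exp_mul_integral_erfcWeight_sin d).const_mul _)).congr_deriv ?_
    rw [gaussDensity_eq]
    ring
  have hconst := is_const_of_deriv_eq_zero (fun d => (hderiv d).differentiableAt)
    (fun d => (hderiv d).deriv) d 0
  have hodd : ∫ s, signErfc s * gaussDensity (0 - s) = 0 := by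
    rw [integral_eq_integral_Ioi_add_neg (integrable_signErfc_mul_gaussDensity 0),
      ← integral_add (integrable_signErfc_mul_gaussDensity 0).integrableOn
        (integrable_signErfc_mul_gaussDensity 0).comp_neg.integrableOn]
    simp [signErfc_neg, gaussDensity_neg]
  simp only [hodd, mul_zero, Real.sin_zero, integral_zero, sub_zero] at hconst
  linarith

lemma integrable_exp_neg_sq_mul_self : Integrable fun t : ℝ => Real.exp (-t ^ 2) * t :=
  integrable_exp_neg_sq_mul continuous_id (C := 1) fun t => by
    simpa using abs_le_one_add_sq t

lemma integrable_exp_neg_sq_mul_sq : Integrable fun t : ℝ => Real.exp (-t ^ 2) * t ^ 2 :=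
  integrable_exp_neg_sq_mul (by fun_prop) (C := 1) fun t => by simp

lemma integral_exp_neg_sq_mul_self : ∫ t : ℝ, Real.exp (-t ^ 2) * t = 0 := by
  have h := integral_eq_zero_of_hasDerivAt_of_integrable
    (fun t => (hasDerivAt_exp_neg_sq t).congr_deriv
      (g' := -2 * (Real.exp (-t ^ 2) * t)) (by ring))
    (integrable_exp_neg_sq_mul_self.const_mul _) integrable_exp_neg_sq
  rw [integral_const_mul] at h
  linarith

lemma integral_exp_neg_sq : ∫ t : ℝ, Real.exp (-t ^ 2) = √π := by
  simpa using integral_gaussian 1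

lemma integral_exp_neg_sq_mul_sq : ∫ t : ℝ, Real.exp (-t ^ 2) * t ^ 2 = √π / 2 := by
  have h := integral_eq_zero_of_hasDerivAt_of_integrable
    (fun t => ((hasDerivAt_exp_neg_sq t).mul (hasDerivAt_id' t)).congr_deriv
      (g' := Real.exp (-t ^ 2) - 2 * (Real.exp (-t ^ 2) * t ^ 2)) (by ring))
    (integrable_exp_neg_sq.sub (integrable_exp_neg_sq_mul_sq.const_mul _))
    integrable_exp_neg_sq_mul_self
  rw [integral_sub integrable_exp_neg_sq (integrable_exp_neg_sq_mul_sq.const_mul _),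
    integral_const_mul, integral_exp_neg_sq] at h
  linarith

lemma volume_restrict_upperHalfPlane :
    (volume : Measure (ℝ × ℝ)).restrict {q | 0 < q.2} =
      volume.prod (volume.restrict (Set.Ioi 0)) := by
  have : {q : ℝ × ℝ | 0 < q.2} = Set.univ ×ˢ Set.Ioi 0 := by
    ext
    simp
  rw [this, Measure.volume_eq_prod, ← Measure.prod_restrict, Measure.restrict_univ]

section UpperHalfPlane

variable {b₀ b₁ b₂ : ℝ → ℝ} (m : ℝ)

lemma integrableOn_upperHalfPlane_gaussian (h₀ : IntegrableOn b₀ (Set.Ioi 0))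
    (h₁ : IntegrableOn b₁ (Set.Ioi 0)) (h₂ : IntegrableOn b₂ (Set.Ioi 0)) :
    IntegrableOn (fun p : ℝ × ℝ => Real.exp (-(p.1 - m) ^ 2) *
      (b₀ p.2 + b₁ p.2 * (p.1 - m) + b₂ p.2 * (p.1 - m) ^ 2)) {q | 0 < q.2} := by
  rw [IntegrableOn, volume_restrict_upperHalfPlane]
  refine (((((integrable_exp_neg_sq.comp_sub_right m).mul_prod h₀).add
    ((integrable_exp_neg_sq_mul_self.comp_sub_right m).mul_prod h₁)).add
    ((integrable_exp_neg_sq_mul_sq.comp_sub_right m).mul_prod h₂))).congr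
    (.of_forall fun p => ?_)
  simp only [Pi.add_apply]
  ring

lemma integral_upperHalfPlane_gaussian (h₀ : IntegrableOn b₀ (Set.Ioi 0))
    (h₁ : IntegrableOn b₁ (Set.Ioi 0)) (h₂ : IntegrableOn b₂ (Set.Ioi 0)) :
    ∫ p in {q : ℝ × ℝ | 0 < q.2}, Real.exp (-(p.1 - m) ^ 2) *
      (b₀ p.2 + b₁ p.2 * (p.1 - m) + b₂ p.2 * (p.1 - m) ^ 2) =
      √π * ((∫ Y in Set.Ioi 0, b₀ Y) + (∫ Y in Set.Ioi 0, b₂ Y) / 2) := by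
  rw [volume_restrict_upperHalfPlane]
  have i₀ := (integrable_exp_neg_sq.comp_sub_right m).mul_prod h₀
  have i₁ := (integrable_exp_neg_sq_mul_self.comp_sub_right m).mul_prod h₁
  have i₂ := (integrable_exp_neg_sq_mul_sq.comp_sub_right m).mul_prod h₂
  have hsplit : ∀ p : ℝ × ℝ, Real.exp (-(p.1 - m) ^ 2) *
      (b₀ p.2 + b₁ p.2 * (p.1 - m) + b₂ p.2 * (p.1 - m) ^ 2) =
      Real.exp (-(p.1 - m) ^ 2) * b₀ p.2 + Real.exp (-(p.1 - m) ^ 2) * (p.1 - m) * b₁ p.2 +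
        Real.exp (-(p.1 - m) ^ 2) * (p.1 - m) ^ 2 * b₂ p.2 := fun p => by ring
  simp only [hsplit]
  have i₀₁ : Integrable (fun p : ℝ × ℝ => Real.exp (-(p.1 - m) ^ 2) * b₀ p.2 +
      Real.exp (-(p.1 - m) ^ 2) * (p.1 - m) * b₁ p.2)
      (volume.prod (volume.restrict (Set.Ioi 0))) := i₀.add i₁
  rw [integral_add i₀₁ i₂, integral_add i₀ i₁,
    integral_prod_mul (fun X : ℝ => Real.exp (-(X - m) ^ 2)),
    integral_prod_mul (fun X : ℝ => Real.exp (-(X - m) ^ 2) * (X - m)),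
    integral_prod_mul (fun X : ℝ => Real.exp (-(X - m) ^ 2) * (X - m) ^ 2),
    integral_sub_right_eq_self (fun t : ℝ => Real.exp (-t ^ 2)),
    integral_sub_right_eq_self (fun t : ℝ => Real.exp (-t ^ 2) * t),
    integral_sub_right_eq_self (fun t : ℝ => Real.exp (-t ^ 2) * t ^ 2),
    integral_exp_neg_sq, integral_exp_neg_sq_mul_self, integral_exp_neg_sq_mul_sq]
  ring

end UpperHalfPlane

lemma integral_matrix_map_ofReal {α : Type*} [MeasurableSpace α] {μ : Measure α}
    {A : α → Matrix (Fin 2) (Fin 2) ℝ} (hA : ∀ i j, Integrable (fun a => A a i j) μ) :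
    ∫ a, (A a).map Complex.ofReal ∂μ =
      (Matrix.of fun i j => ∫ a, A a i j ∂μ).map Complex.ofReal := by
  ext i j
  have h : ∀ i j, Integrable (fun a => (A a i j : ℂ)) μ := fun i j => (hA i j).ofReal
  change (∫ a, (fun i j => (A a i j : ℂ) : Fin 2 → Fin 2 → ℂ) ∂μ) i j = _
  rw [eval_integral (fun i => Integrable.of_eval (h i)), eval_integral (h i)]
  exact integral_ofReal

/-- The real-real kernel `K̃_{r,r}(x, y)` as a function of `s = x - y`. -/
noncomputable def realKernel (s : ℝ) : Matrix (Fin 2) (Fin 2) ℝ :=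
  !![gaussDensity s, s * gaussDensity s; signErfc s, gaussDensity s]

lemma Ktrr_eq_map_realKernel (x y : ℝ) :
    Ktrr x y = (realKernel (x - y)).map Complex.ofReal := by
  ext i j
  fin_cases i <;> fin_cases j <;>
    simp [Ktrr, Krr, J2, realKernel, Matrix.mul_apply, gaussDensity, signErfc]
  ring

lemma integral_Ktrr_mul_Ktrr (x y : ℝ) :
    ∫ u, Ktrr x u * Ktrr u y =
      (!![Real.exp (-(x - y) ^ 2 / 4) / √π - gaussDensity (x - y),
          (x - y) * (Real.exp (-(x - y) ^ 2 / 4) / (2 * √π));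
          2 * ∫ s, signErfc s * gaussDensity (x - y - s),
          Real.exp (-(x - y) ^ 2 / 4) / √π - gaussDensity (x - y)]).map Complex.ofReal := by
  set d := x - y with hd
  have hshift : ∀ u, Ktrr x u * Ktrr u y =
      (fun s => (realKernel s * realKernel (d - s)).map Complex.ofReal) (x - u) := fun u => by
    have : d - (x - u) = u - y := by rw [hd]; ring
    simp only [this, Ktrr_eq_map_realKernel]
    exact (Matrix.map_mul (f := Complex.ofRealHom)).symm
  have hφ := integrable_gaussDensity_mul_gaussDensity d
  have hε := integrable_signErfc_mul_gaussDensity d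
  have hψ := integrable_signErfc_mul_deriv_gaussDensity d
  have hε' := hε.comp_sub_left d
  have hψ' := hψ.comp_sub_left d
  have iε := integral_sub_left_eq_self (fun s => signErfc s * gaussDensity (d - s)) volume d
  have iψ := integral_sub_left_eq_self
    (fun s => signErfc s * ((d - s) * gaussDensity (d - s))) volume d
  simp only [sub_sub_cancel] at hε' hψ' iε iψ
  have e₀₀ : (fun s => (realKernel s * realKernel (d - s)) 0 0) = fun s =>
      gaussDensity s * gaussDensity (d - s) + signErfc (d - s) * (s * gaussDensity s) := by
    ext s; simp [realKernel, Matrix.mul_apply]; ring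
  have e₀₁ : (fun s => (realKernel s * realKernel (d - s)) 0 1) = fun s =>
      d * (gaussDensity s * gaussDensity (d - s)) := by
    ext s; simp [realKernel, Matrix.mul_apply]; ring
  have e₁₀ : (fun s => (realKernel s * realKernel (d - s)) 1 0) = fun s =>
      signErfc s * gaussDensity (d - s) + signErfc (d - s) * gaussDensity s := by
    ext s; simp [realKernel, Matrix.mul_apply]; ring
  have e₁₁ : (fun s => (realKernel s * realKernel (d - s)) 1 1) = fun s =>
      signErfc s * ((d - s) * gaussDensity (d - s)) + gaussDensity s * gaussDensity (d - s) := by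
    ext s; simp [realKernel, Matrix.mul_apply]
  simp only [hshift]
  rw [integral_sub_left_eq_self
    (fun s => (realKernel s * realKernel (d - s)).map Complex.ofReal), integral_matrix_map_ofReal]
  · congr 1
    ext i j
    fin_cases i <;> fin_cases j
    · simp [e₀₀, integral_add hφ hψ', iψ, integral_signErfc_mul_deriv_gaussDensity,
        integral_gaussDensity_mul_gaussDensity]
      ring
    · simp [e₀₁, integral_const_mul, integral_gaussDensity_mul_gaussDensity]
    · simp [e₁₀, integral_add hε hε', iε]
      ring
    · simp [e₁₁, integral_add hψ hφ, integral_signErfc_mul_deriv_gaussDensity,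
        integral_gaussDensity_mul_gaussDensity]
      ring
  · intro i j
    fin_cases i <;> fin_cases j
    · exact e₀₀ ▸ hφ.add hψ'
    · exact e₀₁ ▸ hφ.const_mul d
    · exact e₁₀ ▸ hε.add hε'
    · exact e₁₁ ▸ hψ.add hφ

/-- The product `K̃_{r,c}(x, z) K̃_{c,r}(z, y)` as a function of `d = x - y`,
`t = Re z - (x + y) / 2` and `Y = Im z`. -/
noncomputable def stripKernel (d t Y : ℝ) : Matrix (Fin 2) (Fin 2) ℝ :=
  (Real.exp (-t ^ 2) * (Real.exp (-d ^ 2 / 4) / π * erfcWeight Y)) •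
    !![(t - d / 2) * Real.sin (Y * d) + Y * Real.cos (Y * d),
       (t ^ 2 + Y ^ 2 - d ^ 2 / 4) * Real.sin (Y * d) + Y * d * Real.cos (Y * d);
       -Real.sin (Y * d),
       -(t + d / 2) * Real.sin (Y * d) + Y * Real.cos (Y * d)]

lemma exp_mul_exp_conj (x y X Y : ℝ) :
    Complex.exp (-((x : ℂ) - (X + Y * Complex.I)) ^ 2 / 2) *
        Complex.exp (-((y : ℂ) - (X - Y * Complex.I)) ^ 2 / 2) =
      ((Real.exp (-(X - (x + y) / 2) ^ 2) *
        (Real.exp (-(x - y) ^ 2 / 4) * Real.exp (Y ^ 2)) : ℝ) : ℂ) *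
        ((Real.cos (Y * (x - y)) : ℂ) + Real.sin (Y * (x - y)) * Complex.I) := by
  rw [Complex.ofReal_cos, Complex.ofReal_sin, ← Complex.exp_mul_I, ← Complex.exp_add]
  push_cast
  rw [← Complex.exp_add, ← Complex.exp_add, ← Complex.exp_add]
  congr 1
  linear_combination (-(Y : ℂ) ^ 2) * Complex.I_sq

lemma Ktrc_mul_Ktcr (x y X Y : ℝ) :
    Ktrc x ((X : ℂ) + (Y : ℂ) * Complex.I) * Ktcr ((X : ℂ) + (Y : ℂ) * Complex.I) y =
      (stripKernel (x - y) (X - (x + y) / 2) Y).map Complex.ofReal := by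
  have hconj : (starRingEnd ℂ) ((X : ℂ) + Y * Complex.I) = X - Y * Complex.I := by
    simp [sub_eq_add_neg]
  have him : ((X : ℂ) + Y * Complex.I).im = Y := by simp
  have h1 := exp_mul_exp_conj x y X Y
  have h2 := exp_mul_exp_conj x y X (-Y)
  simp only [neg_mul, Real.cos_neg, Real.sin_neg, Complex.ofReal_neg, neg_sq, sub_neg_eq_add,
    ← sub_eq_add_neg] at h2
  have hc : (1 / √(2 * π) * √(erfc (√2 * Y))) * (1 / √(2 * π) * √(erfc (√2 * Y))) *
      2 * (Real.exp (-(X - (x + y) / 2) ^ 2) *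
        (Real.exp (-(x - y) ^ 2 / 4) * Real.exp (Y ^ 2))) =
      Real.exp (-(X - (x + y) / 2) ^ 2) *
        (Real.exp (-(x - y) ^ 2 / 4) / π * erfcWeight Y) := by
    have e1 := Real.mul_self_sqrt (erfc_nonneg (√2 * Y))
    have e2 : √(2 * π) * √(2 * π) = 2 * π := Real.mul_self_sqrt (by positivity)
    rw [mul_mul_mul_comm (1 / √(2 * π)), e1, div_mul_div_comm, e2, erfcWeight]
    field_simp
  have hcC := congrArg Complex.ofReal hc
  rw [stripKernel]
  simp only [Ktrc, Ktcr, Kcr, Krc, J2, hconj, him]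
  generalize Real.exp (-(X - (x + y) / 2) ^ 2) *
        (Real.exp (-(x - y) ^ 2 / 4) / π * erfcWeight Y) = Γ at *
  generalize Real.exp (-(X - (x + y) / 2) ^ 2) *
        (Real.exp (-(x - y) ^ 2 / 4) * Real.exp (Y ^ 2)) = R at *
  generalize 1 / √(2 * π) * √(erfc (√2 * Y)) = c at *
  generalize Real.cos (Y * (x - y)) = C at *
  generalize Real.sin (Y * (x - y)) = S at *
  generalize Complex.exp (-((x : ℂ) - (X + Y * Complex.I)) ^ 2 / 2) = Px at *
  generalize Complex.exp (-((y : ℂ) - (X + Y * Complex.I)) ^ 2 / 2) = Py at *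
  generalize Complex.exp (-((x : ℂ) - (X - Y * Complex.I)) ^ 2 / 2) = Qx at *
  generalize Complex.exp (-((y : ℂ) - (X - Y * Complex.I)) ^ 2 / 2) = Qy at *
  push_cast at hcC
  ext i j
  fin_cases i <;> fin_cases j <;> simp [Matrix.mul_apply]
  · linear_combination (c ^ 2 * Complex.I * (X - Y * Complex.I - x)) * h2 -
      (c ^ 2 * Complex.I * (X + Y * Complex.I - x)) * h1 +
      (-2 * c ^ 2 * R * ((X - x) * S + Y * C)) * Complex.I_sq + ((X - x) * S + Y * C) * hcC
  · linear_combination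
      (c ^ 2 * Complex.I * (X - Y * Complex.I - x) * (X + Y * Complex.I - y)) * h2 -
      (c ^ 2 * Complex.I * (X + Y * Complex.I - x) * (X - Y * Complex.I - y)) * h1 +
      (c ^ 2 * R * (-2 * ((X - x) * (X - y) * S + Y * (x - y) * C) +
        2 * Y ^ 2 * S * (Complex.I ^ 2 - 1))) * Complex.I_sq +
      (((X - x) * (X - y) + Y ^ 2) * S + Y * (x - y) * C) * hcC
  · linear_combination (-c ^ 2 * Complex.I) * h2 + (c ^ 2 * Complex.I) * h1 +
      (2 * S * c ^ 2 * R) * Complex.I_sq - S * hcC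
  · linear_combination (-c ^ 2 * Complex.I * (X + Y * Complex.I - y)) * h2 +
      (c ^ 2 * Complex.I * (X - Y * Complex.I - y)) * h1 +
      (2 * c ^ 2 * R * ((X - y) * S - Y * C)) * Complex.I_sq - ((X - y) * S - Y * C) * hcC

lemma integral_stripKernel (d m : ℝ) :
    ∫ p in {q : ℝ × ℝ | 0 < q.2}, (stripKernel d (p.1 - m) p.2).map Complex.ofReal =
      (√π * (Real.exp (-d ^ 2 / 4) / π)) •
      (!![-1 / 2 + √2 / 2 * Real.exp (-d ^ 2 / 4),
          d * (-1 / 4 + √2 / 2 * Real.exp (-d ^ 2 / 4));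
          -∫ Y in Set.Ioi 0, erfcWeight Y * Real.sin (Y * d),
          -1 / 2 + √2 / 2 * Real.exp (-d ^ 2 / 4)]).map Complex.ofReal := by
  set A := Real.exp (-d ^ 2 / 4) / π with hA
  have hsin := (integrableOn_erfcWeight_mul_sin d).const_mul A
  have hlin := (integrableOn_erfcWeight_linear d).const_mul A
  have hquad := (integrableOn_erfcWeight_quadratic 0 d).const_mul A
  have h0 : IntegrableOn (fun _ : ℝ => (0 : ℝ)) (Set.Ioi 0) := integrableOn_zero
  have e₀₀ : (fun p : ℝ × ℝ => stripKernel d (p.1 - m) p.2 0 0) = fun p =>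
      Real.exp (-(p.1 - m) ^ 2) * (A * (erfcWeight p.2 *
        (-(d / 2) * Real.sin (p.2 * d) + p.2 * Real.cos (p.2 * d))) +
        A * (erfcWeight p.2 * Real.sin (p.2 * d)) * (p.1 - m) + 0 * (p.1 - m) ^ 2) := by
    ext p; simp [stripKernel, ← hA]; ring
  have e₀₁ : (fun p : ℝ × ℝ => stripKernel d (p.1 - m) p.2 0 1) = fun p =>
      Real.exp (-(p.1 - m) ^ 2) * (A * (erfcWeight p.2 *
        ((0 + p.2 ^ 2 - d ^ 2 / 4) * Real.sin (p.2 * d) + p.2 * d * Real.cos (p.2 * d))) +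
        0 * (p.1 - m) + A * (erfcWeight p.2 * Real.sin (p.2 * d)) * (p.1 - m) ^ 2) := by
    ext p; simp [stripKernel, ← hA]; ring
  have e₁₀ : (fun p : ℝ × ℝ => stripKernel d (p.1 - m) p.2 1 0) = fun p =>
      Real.exp (-(p.1 - m) ^ 2) * (-(A * (erfcWeight p.2 * Real.sin (p.2 * d))) +
        0 * (p.1 - m) + 0 * (p.1 - m) ^ 2) := by
    ext p; simp [stripKernel, ← hA]; ring
  have e₁₁ : (fun p : ℝ × ℝ => stripKernel d (p.1 - m) p.2 1 1) = fun p =>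
      Real.exp (-(p.1 - m) ^ 2) * (A * (erfcWeight p.2 *
        (-(d / 2) * Real.sin (p.2 * d) + p.2 * Real.cos (p.2 * d))) +
        -(A * (erfcWeight p.2 * Real.sin (p.2 * d))) * (p.1 - m) + 0 * (p.1 - m) ^ 2) := by
    ext p; simp [stripKernel, ← hA]; ring
  have i₀₀ := integral_upperHalfPlane_gaussian m hlin hsin h0
  have i₀₁ := integral_upperHalfPlane_gaussian m hquad h0 hsin
  have i₁₀ := integral_upperHalfPlane_gaussian m hsin.neg h0 h0
  have i₁₁ := integral_upperHalfPlane_gaussian m hlin hsin.neg h0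
  have hquad_eq : (∫ Y in Set.Ioi 0, A * (erfcWeight Y *
        ((0 + Y ^ 2 - d ^ 2 / 4) * Real.sin (Y * d) + Y * d * Real.cos (Y * d)))) +
        (∫ Y in Set.Ioi 0, A * (erfcWeight Y * Real.sin (Y * d))) / 2 =
      A * (d * (-1 / 4 + √2 / 2 * Real.exp (-d ^ 2 / 4))) := by
    rw [← integral_erfcWeight_quadratic, ← integral_const_mul, ← integral_div,
      ← integral_add hquad (hsin.div_const 2)]
    congr 1 with Y
    ring
  rw [hquad_eq] at i₀₁
  simp only [Pi.neg_apply, integral_const_mul, integral_erfcWeight_linear, integral_zero,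
    integral_neg] at i₀₀ i₁₀ i₁₁
  rw [integral_matrix_map_ofReal]
  · ext i j
    fin_cases i <;> fin_cases j
    · have h := (congrArg (fun f => ∫ p in {q : ℝ × ℝ | 0 < q.2}, f p) e₀₀).trans i₀₀
      simp only [Matrix.map_apply, Matrix.of_apply, Matrix.smul_apply, Fin.zero_eta, h]
      simp
      ring
    · have h := (congrArg (fun f => ∫ p in {q : ℝ × ℝ | 0 < q.2}, f p) e₀₁).trans i₀₁
      simp only [Matrix.map_apply, Matrix.of_apply, Matrix.smul_apply, Fin.zero_eta, Fin.mk_one, h]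
      simp
      ring
    · have h := (congrArg (fun f => ∫ p in {q : ℝ × ℝ | 0 < q.2}, f p) e₁₀).trans i₁₀
      simp only [Matrix.map_apply, Matrix.of_apply, Matrix.smul_apply, Fin.zero_eta, Fin.mk_one, h]
      simp
      ring
    · have h := (congrArg (fun f => ∫ p in {q : ℝ × ℝ | 0 < q.2}, f p) e₁₁).trans i₁₁
      simp only [Matrix.map_apply, Matrix.of_apply, Matrix.smul_apply, Fin.mk_one, h]
      simp
      ring
  · intro i j
    fin_cases i <;> fin_cases j
    · exact e₀₀ ▸ integrableOn_upperHalfPlane_gaussian m hlin hsin h0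
    · exact e₀₁ ▸ integrableOn_upperHalfPlane_gaussian m hquad h0 hsin
    · exact e₁₀ ▸ integrableOn_upperHalfPlane_gaussian m hsin.neg h0 h0
    · exact e₁₁ ▸ integrableOn_upperHalfPlane_gaussian m hlin hsin.neg h0

/-- First integration formula (real-real) for products of bulk-scaled real Ginibre matrix
kernels: `∫ K̃_{r,r}(x,u)K̃_{r,r}(u,y) du + 2∫_{ℝ₊²} K̃_{r,c}(x,z)K̃_{c,r}(z,y) d²z
  = K̃_{r,r}(x,y)[[0,0],[0,1]] + [[1,0],[0,0]]K̃_{r,r}(x,y)`. -/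
theorem stmt_16 (x y : ℝ) :
    (∫ u : ℝ, Ktrr x u * Ktrr u y) +
      (2 : ℂ) • (∫ p in {q : ℝ × ℝ | 0 < q.2},
        Ktrc x ((p.1 : ℂ) + (p.2 : ℂ) * Complex.I) *
          Ktcr ((p.1 : ℂ) + (p.2 : ℂ) * Complex.I) y) =
      Ktrr x y * !![0, 0; 0, 1] + !![1, 0; 0, 0] * Ktrr x y := by
  simp only [Ktrc_mul_Ktcr]
  rw [integral_Ktrr_mul_Ktrr, integral_stripKernel, Ktrr_eq_map_realKernel]
  simp only [integral_signErfc_mul_gaussDensity]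
  have hpi : √π * (Real.exp (-(x - y) ^ 2 / 4) / π) = Real.exp (-(x - y) ^ 2 / 4) / √π := by
    have : √π * √π = π := Real.mul_self_sqrt pi_pos.le
    field_simp
    linear_combination this
  have hmap : ∀ a b c d : ℝ, (!![a, b; c, d]).map Complex.ofReal =
      !![(a : ℂ), (b : ℂ); (c : ℂ), (d : ℂ)] := fun a b c d => by
    ext i j
    fin_cases i <;> fin_cases j <;> rfl
  rw [hpi, realKernel, gaussDensity_eq]
  generalize Real.exp (-(x - y) ^ 2 / 4) = E
  generalize x - y = d
  generalize ∫ Y in Set.Ioi 0, erfcWeight Y * Real.sin (Y * d) = S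
  generalize signErfc d = ε
  rw [hmap, hmap, hmap]
  ext i j
  fin_cases i <;> fin_cases j <;> simp <;> ring
end

section
/- With the 2×2 matrix kernels K̃_{c,c}, K̃_{c,r}, K̃_{r,c} defined below, let y₀ ≥ 0 be real, set z = i·y₀, and let α be a real number with |α| < 1. Then 2·∫_{ℝ₊²} e^{α·w²}·K̃_{c,c}(z,w)·K̃_{c,c}(w,z) d²w + ∫_{−∞}^{∞} e^{α·x²}·K̃_{c,r}(z,x)·K̃_{r,c}(x,z) dx = 2·e^{α·z²}·K̃_{c,c}(z,z), where ℝ₊² denotes the open upper half-plane {X + iY : X ∈ ℝ, Y > 0}, d²w = dX dY, and w² = (X + iY)² (so e^{α·w²} is a complex scalar and e^{α·z²} = e^{−α·y₀²}). -/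
open MeasureTheory Real Matrix

attribute [local instance] Matrix.normedAddCommGroup Matrix.normedSpace

lemma erfc_sqrt_two_mul_le {v : ℝ} (hv : 0 ≤ v) : erfc (√2 * v) ≤ Real.exp (-2 * v ^ 2) := by
  refine (erfc_le_exp_neg_sq (by positivity)).trans_eq ?_
  rw [mul_pow, Real.sq_sqrt (by norm_num)]
  ring_nf

lemma hasDerivAt_erfc_sqrt_two_mul (v : ℝ) :
    HasDerivAt (fun v => erfc (√2 * v)) (-(√(8 / π) * Real.exp (-2 * v ^ 2))) v := by
  have h := (hasDerivAt_erfc (√2 * v)).comp v ((hasDerivAt_id v).const_mul √2)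
  refine h.congr_deriv ?_
  rw [mul_pow, Real.sq_sqrt (by norm_num), Real.sqrt_div (by norm_num),
    show (8 : ℝ) = 2 ^ 2 * 2 by norm_num, Real.sqrt_mul (by norm_num), Real.sqrt_sq (by norm_num)]
  ring_nf

lemma integrable_exp_quadratic {a : ℝ} (ha : 0 < a) (c d : ℝ) :
    Integrable fun x : ℝ => Real.exp (-a * x ^ 2 + c * x + d) := by
  have h := (integrable_cexp_quadratic (b := a) (by simpa using ha) c d).norm
  refine h.congr (.of_forall fun x => ?_)
  simp only [Complex.norm_exp]
  norm_cast

lemma integrable_one_add_sq_mul_exp_quadratic {a : ℝ} (ha : 0 < a) (c d : ℝ) :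
    Integrable fun x : ℝ => (1 + x ^ 2) * Real.exp (-a * x ^ 2 + c * x + d) := by
  refine ((integrable_exp_quadratic (half_pos ha) c d).const_mul (1 + 2 / a)).mono'
    (by fun_prop) (.of_forall fun x => ?_)
  rw [Real.norm_of_nonneg (by positivity)]
  have h1 : 1 + x ^ 2 ≤ (1 + 2 / a) * Real.exp (a / 2 * x ^ 2) := by
    have h2 := Real.add_one_le_exp (a / 2 * x ^ 2)
    calc 1 + x ^ 2 ≤ (1 + 2 / a) * (a / 2 * x ^ 2 + 1) := by
          have : (1 + 2 / a) * (a / 2 * x ^ 2 + 1) = 1 + x ^ 2 + (2 / a + a / 2 * x ^ 2) := by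
            field_simp; ring
          rw [this]
          have : 0 ≤ 2 / a + a / 2 * x ^ 2 := by positivity
          linarith
      _ ≤ _ := by gcongr
  calc _ ≤ (1 + 2 / a) * Real.exp (a / 2 * x ^ 2) * Real.exp (-a * x ^ 2 + c * x + d) := by gcongr
    _ = _ := by rw [mul_assoc, ← Real.exp_add]; ring_nf

lemma integrable_mul_cexp_quadratic {a : ℝ} (ha : 0 < a) (c : ℂ) {p : ℝ → ℂ} (hp : Continuous p)
    (hle : ∀ x, ‖p x‖ ≤ 1 + x ^ 2) :
    Integrable fun x : ℝ => p x * Complex.exp (-a * x ^ 2 + c * x) := by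
  refine (integrable_one_add_sq_mul_exp_quadratic ha c.re 0).mono' (by fun_prop)
    (.of_forall fun x => ?_)
  rw [norm_mul, Complex.norm_exp]
  have : (-(a : ℂ) * x ^ 2 + c * x).re = -a * x ^ 2 + c.re * x + 0 := by
    have : (-(a : ℂ) * x ^ 2 + c * x) = ((-a * x ^ 2 : ℝ) : ℂ) + c * (x : ℝ) := by push_cast; ring
    rw [this, Complex.add_re, Complex.ofReal_re, Complex.re_mul_ofReal, add_zero]
  rw [this]
  gcongr
  exact hle x

lemma hasDerivAt_cexp_quadratic (a : ℝ) (c : ℂ) (x : ℝ) :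
    HasDerivAt (fun x : ℝ => Complex.exp (-a * x ^ 2 + c * x))
      ((-2 * a * x + c) * Complex.exp (-a * x ^ 2 + c * x)) x := by
  have h1 : HasDerivAt (fun x : ℝ => (x : ℂ)) 1 x := Complex.ofRealCLM.hasDerivAt
  have h := (((h1.pow 2).const_mul (-(a : ℂ))).add (h1.const_mul c)).cexp
  refine h.congr_deriv ?_
  simp
  ring

lemma norm_ofReal_le_one_add_sq (x : ℝ) : ‖(x : ℂ)‖ ≤ 1 + x ^ 2 := by
  rw [Complex.norm_real, Real.norm_eq_abs]
  nlinarith [sq_abs x, sq_nonneg (|x| - 1)]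

lemma norm_ofReal_sq_le_one_add_sq (x : ℝ) : ‖(x : ℂ) ^ 2‖ ≤ 1 + x ^ 2 := by
  rw [norm_pow, Complex.norm_real, Real.norm_eq_abs, sq_abs]
  linarith

lemma integral_mul_cexp_quadratic {a : ℝ} (ha : 0 < a) (c : ℂ) :
    ∫ x : ℝ, (x : ℂ) * Complex.exp (-a * x ^ 2 + c * x) =
      c / (2 * a) * ∫ x : ℝ, Complex.exp (-a * x ^ 2 + c * x) := by
  have i0 := integrable_mul_cexp_quadratic ha c (p := fun _ => 1) continuous_const
    (fun x => by simp; positivity)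
  have i1 := integrable_mul_cexp_quadratic ha c Complex.continuous_ofReal norm_ofReal_le_one_add_sq
  simp only [one_mul] at i0
  have hd : (fun x : ℝ => (-2 * a * x + c) * Complex.exp (-a * x ^ 2 + c * x)) =
      fun x : ℝ => (-2 * a : ℂ) * (x * Complex.exp (-a * x ^ 2 + c * x)) +
        c * Complex.exp (-a * x ^ 2 + c * x) := by
    funext x; ring
  have h := integral_eq_zero_of_hasDerivAt_of_integrable (hasDerivAt_cexp_quadratic a c)
    (by rw [hd]; exact (i1.const_mul _).add (i0.const_mul _)) i0
  rw [hd, integral_add (i1.const_mul _) (i0.const_mul _), integral_const_mul,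
    integral_const_mul] at h
  have : (a : ℂ) ≠ 0 := by exact_mod_cast ha.ne'
  rw [div_mul_eq_mul_div, eq_div_iff (by simpa using this)]
  linear_combination -h

lemma integral_sq_mul_cexp_quadratic {a : ℝ} (ha : 0 < a) (c : ℂ) :
    ∫ x : ℝ, (x : ℂ) ^ 2 * Complex.exp (-a * x ^ 2 + c * x) =
      (1 / (2 * a) + c ^ 2 / (4 * a ^ 2)) * ∫ x : ℝ, Complex.exp (-a * x ^ 2 + c * x) := by
  have i0 := integrable_mul_cexp_quadratic ha c (p := fun _ => 1) continuous_const
    (fun x => by simp; positivity)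
  have i1 := integrable_mul_cexp_quadratic ha c Complex.continuous_ofReal norm_ofReal_le_one_add_sq
  have i2 := integrable_mul_cexp_quadratic ha c (by fun_prop) norm_ofReal_sq_le_one_add_sq
  simp only [one_mul] at i0
  have hd (x : ℝ) : HasDerivAt (fun x : ℝ => x * Complex.exp (-a * x ^ 2 + c * x))
      (((-2 * a : ℂ) * (x ^ 2 * Complex.exp (-a * x ^ 2 + c * x)) +
        c * (x * Complex.exp (-a * x ^ 2 + c * x))) + Complex.exp (-a * x ^ 2 + c * x)) x := by
    have h1 : HasDerivAt (fun x : ℝ => (x : ℂ)) 1 x := Complex.ofRealCLM.hasDerivAt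
    refine (h1.mul (hasDerivAt_cexp_quadratic a c x)).congr_deriv ?_
    ring
  have j : Integrable fun x : ℝ => (-2 * a : ℂ) * (x ^ 2 * Complex.exp (-a * x ^ 2 + c * x)) +
      c * (x * Complex.exp (-a * x ^ 2 + c * x)) := (i2.const_mul _).add (i1.const_mul _)
  have h := integral_eq_zero_of_hasDerivAt_of_integrable hd (j.add i0) i1
  rw [integral_add j i0, integral_add (i2.const_mul _) (i1.const_mul _), integral_const_mul,
    integral_const_mul, integral_mul_cexp_quadratic ha] at h
  have : (a : ℂ) ≠ 0 := by exact_mod_cast ha.ne'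
  generalize (∫ x : ℝ, Complex.exp (-a * x ^ 2 + c * x)) = M at h ⊢
  field_simp at h ⊢
  linear_combination -2 * h

lemma integral_cexp_neg_mul_sq_add {a : ℝ} (ha : 0 < a) (c : ℂ) :
    ∫ x : ℝ, Complex.exp (-a * x ^ 2 + c * x) = √(π / a) * Complex.exp (c ^ 2 / (4 * a)) := by
  have h := integral_cexp_quadratic (b := -a) (by simpa using ha) c 0
  simp only [add_zero] at h
  rw [h, neg_neg, ← Complex.ofReal_div, Real.sqrt_eq_rpow, Complex.ofReal_cpow (by positivity)]
  congr 2
  · push_cast; rfl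
  · ring

/-- The contribution to the complex screening integrand of a pair of points at
distance `√(x² + (v + y)²)`, with weight `e^{(1 - a) w²}`, `w = x + iv`. -/
noncomputable def screeningTerm (a y : ℝ) (p : ℝ × ℝ) : ℂ :=
  ((erfc (√2 * p.2) * (p.1 ^ 2 + (p.2 + y) ^ 2) : ℝ) : ℂ) *
    Complex.exp ((1 - a) * (p.1 + p.2 * Complex.I) ^ 2 - p.1 ^ 2 + (p.2 + y) ^ 2)

/-- A primitive of the Gaussian part of the `x`-integral of `screeningTerm`. -/
noncomputable def screeningPrimitive (a y v : ℝ) : ℝ :=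
  (v / (2 * a) + y / 2) * Real.exp ((2 - 1 / a) * v ^ 2 + 2 * y * v)

/-- The derivative of `screeningPrimitive`. -/
noncomputable def screeningDensity (a y v : ℝ) : ℝ :=
  (1 / (2 * a) + (v / (2 * a) + y / 2) * (2 * (2 - 1 / a) * v + 2 * y)) *
    Real.exp ((2 - 1 / a) * v ^ 2 + 2 * y * v)

lemma hasDerivAt_screeningPrimitive (a y v : ℝ) :
    HasDerivAt (screeningPrimitive a y) (screeningDensity a y v) v := by
  have h1 : HasDerivAt (fun v : ℝ => v / (2 * a) + y / 2) (1 / (2 * a)) v :=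
    ((hasDerivAt_id v).div_const _).add_const _
  have h2 := ((((hasDerivAt_id v).pow 2).const_mul (2 - 1 / a)).add
    ((hasDerivAt_id v).const_mul (2 * y))).exp
  refine (h1.mul h2).congr_deriv ?_
  simp [screeningDensity]
  ring

lemma continuous_screeningTerm (a y : ℝ) : Continuous (screeningTerm a y) := by
  have := continuous_erfc
  unfold screeningTerm
  fun_prop

lemma integrable_screeningTerm {a : ℝ} (ha : 0 < a) (ha2 : a < 2) (y : ℝ) :
    Integrable (screeningTerm a y) (volume.prod (volume.restrict (Set.Ioi 0))) := by
  have hx := integrable_one_add_sq_mul_exp_quadratic ha 0 0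
  have hv := ((integrable_one_add_sq_mul_exp_quadratic (sub_pos.2 ha2) (2 * y) (y ^ 2)).const_mul
    (2 * (1 + y ^ 2))).integrableOn (s := Set.Ioi 0)
  refine (hx.mul_prod hv).mono' (continuous_screeningTerm a y).aestronglyMeasurable ?_
  have hpos : ∀ᵐ p : ℝ × ℝ ∂(volume.prod (volume.restrict (Set.Ioi 0))), 0 < p.2 := by
    have h := Measure.quasiMeasurePreserving_snd (μ := (volume : Measure ℝ))
      (ν := volume.restrict (Set.Ioi (0 : ℝ)))
    exact h.ae (ae_restrict_mem measurableSet_Ioi)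
  filter_upwards [hpos] with ⟨x, v⟩ hv
  simp only at hv ⊢
  have hre : ((1 - a : ℂ) * (x + v * Complex.I) ^ 2 - x ^ 2 + (v + y) ^ 2).re =
      (1 - a) * (x ^ 2 - v ^ 2) - x ^ 2 + (v + y) ^ 2 := by
    have : ((1 - a : ℂ) * (x + v * Complex.I) ^ 2 - x ^ 2 + (v + y) ^ 2) =
        (((1 - a) * (x ^ 2 - v ^ 2) - x ^ 2 + (v + y) ^ 2 : ℝ) : ℂ) +
          ((2 * (1 - a) * x * v : ℝ) : ℂ) * Complex.I := by
      push_cast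
      linear_combination (1 - a : ℂ) * v ^ 2 * Complex.I_sq
    rw [this, Complex.add_re, Complex.ofReal_re, Complex.re_ofReal_mul, Complex.I_re]
    ring
  rw [screeningTerm, norm_mul, Complex.norm_exp, hre, Complex.norm_real, norm_mul,
    Real.norm_of_nonneg (erfc_nonneg _), Real.norm_of_nonneg (by positivity)]
  calc _ ≤ Real.exp (-2 * v ^ 2) * ((1 + x ^ 2) * (2 * (1 + y ^ 2) * (1 + v ^ 2))) *
        Real.exp ((1 - a) * (x ^ 2 - v ^ 2) - x ^ 2 + (v + y) ^ 2) := by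
        gcongr
        · exact erfc_sqrt_two_mul_le hv.le
        · nlinarith [sq_nonneg (v - y), sq_nonneg (v * y), mul_nonneg (sq_nonneg x)
            (add_nonneg (add_nonneg zero_le_one (sq_nonneg y))
              (add_nonneg (sq_nonneg v) (sq_nonneg (v * y))))]
    _ = (1 + x ^ 2) * (2 * (1 + y ^ 2)) * (1 + v ^ 2) * (Real.exp (-2 * v ^ 2) *
        Real.exp ((1 - a) * (x ^ 2 - v ^ 2) - x ^ 2 + (v + y) ^ 2)) := by ring
    _ = (1 + x ^ 2) * (2 * (1 + y ^ 2)) * (1 + v ^ 2) * (Real.exp (-a * x ^ 2 + 0 * x + 0) *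
        Real.exp (-(2 - a) * v ^ 2 + 2 * y * v + y ^ 2)) := by
        rw [← Real.exp_add, ← Real.exp_add]; ring_nf
    _ = _ := by ring

lemma integral_screeningTerm_left {a : ℝ} (ha : 0 < a) (y v : ℝ) :
    ∫ x, screeningTerm a y (x, v) =
      ((√(π / a) * Real.exp (y ^ 2) * (erfc (√2 * v) * screeningDensity a y v) : ℝ) : ℂ) := by
  set c : ℂ := 2 * (1 - a) * v * Complex.I with hc
  have i0 := integrable_mul_cexp_quadratic ha c (p := fun _ => 1) continuous_const
    (fun x => by simp; positivity)
  have i2 := integrable_mul_cexp_quadratic ha c (by fun_prop) norm_ofReal_sq_le_one_add_sq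
  simp only [one_mul] at i0
  have hF (x : ℝ) : screeningTerm a y (x, v) =
      (erfc (√2 * v) * Complex.exp (-(1 - a) * v ^ 2 + (v + y) ^ 2)) *
      (x ^ 2 * Complex.exp (-a * x ^ 2 + c * x) +
        (v + y) ^ 2 * Complex.exp (-a * x ^ 2 + c * x)) := by
    have : Complex.exp ((1 - a) * (x + v * Complex.I) ^ 2 - x ^ 2 + (v + y) ^ 2) =
        Complex.exp (-(1 - a) * v ^ 2 + (v + y) ^ 2) * Complex.exp (-a * x ^ 2 + c * x) := by
      rw [← Complex.exp_add, hc]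
      congr 1
      linear_combination (1 - a : ℂ) * v ^ 2 * Complex.I_sq
    simp only [screeningTerm, this]
    push_cast
    ring
  simp_rw [hF]
  rw [integral_const_mul, integral_add i2 (i0.const_mul _), integral_const_mul,
    integral_sq_mul_cexp_quadratic ha, integral_cexp_neg_mul_sq_add ha]
  have hac : (a : ℂ) ≠ 0 := by exact_mod_cast ha.ne'
  have hc2 : c ^ 2 = -(4 * (1 - a) ^ 2 * v ^ 2) := by
    rw [hc]
    linear_combination 4 * (1 - a : ℂ) ^ 2 * v ^ 2 * Complex.I_sq
  have he : Complex.exp (-(1 - a) * v ^ 2 + (v + y) ^ 2) * Complex.exp (c ^ 2 / (4 * a)) =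
      Complex.exp (y ^ 2) * Complex.exp ((2 - 1 / a) * v ^ 2 + 2 * y * v) := by
    rw [← Complex.exp_add, ← Complex.exp_add, hc2]
    congr 1
    field_simp
    ring
  rw [screeningDensity]
  push_cast
  have hq : (1 / (2 * a) + c ^ 2 / (4 * a ^ 2) + (v + y) ^ 2 : ℂ) =
      1 / (2 * a) + (v / (2 * a) + y / 2) * (2 * (2 - 1 / a) * v + 2 * y) := by
    rw [hc2]
    field_simp
    ring
  rw [← hq]
  linear_combination (erfc (√2 * v) * (1 / (2 * a) + c ^ 2 / (4 * a ^ 2) + (v + y) ^ 2) *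
    √(π / a) : ℂ) * he

lemma integrable_quadratic_mul_exp {a : ℝ} (ha : 0 < a) (k₀ k₁ k₂ c : ℝ) :
    Integrable fun x : ℝ => (k₀ + k₁ * x + k₂ * x ^ 2) * Real.exp (-a * x ^ 2 + c * x) := by
  refine ((integrable_one_add_sq_mul_exp_quadratic ha c 0).const_mul (|k₀| + |k₁| + |k₂|)).mono'
    (by fun_prop) (.of_forall fun x => ?_)
  rw [norm_mul, Real.norm_of_nonneg (Real.exp_pos _).le, add_zero, ← mul_assoc]
  gcongr
  have hx : |x| ≤ 1 + x ^ 2 := by nlinarith [sq_abs x, sq_nonneg (|x| - 1)]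
  calc ‖k₀ + k₁ * x + k₂ * x ^ 2‖ ≤ |k₀| + |k₁| * |x| + |k₂| * x ^ 2 := by
        refine (norm_add₃_le).trans_eq ?_
        simp
    _ ≤ |k₀| * (1 + x ^ 2) + |k₁| * (1 + x ^ 2) + |k₂| * (1 + x ^ 2) := by
        gcongr
        · nlinarith [abs_nonneg k₀, mul_nonneg (abs_nonneg k₀) (sq_nonneg x)]
        · linarith
    _ = _ := by ring

lemma exp_mul_screeningPrimitive (a y v : ℝ) :
    Real.exp (-2 * v ^ 2) * screeningPrimitive a y v =
      (v / (2 * a) + y / 2) * Real.exp (-a⁻¹ * v ^ 2 + 2 * y * v) := by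
  rw [screeningPrimitive, mul_left_comm, ← Real.exp_add]
  ring_nf

lemma integrable_exp_mul_screeningPrimitive {a : ℝ} (ha : 0 < a) (y : ℝ) :
    Integrable fun v => Real.exp (-2 * v ^ 2) * screeningPrimitive a y v := by
  simp_rw [exp_mul_screeningPrimitive]
  refine (integrable_quadratic_mul_exp (inv_pos.2 ha) (y / 2) (1 / (2 * a)) 0 (2 * y)).congr
    (.of_forall fun v => ?_)
  simp only
  ring

lemma integrable_exp_mul_screeningDensity {a : ℝ} (ha : 0 < a) (y : ℝ) :
    Integrable fun v => Real.exp (-2 * v ^ 2) * screeningDensity a y v := by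
  refine (integrable_quadratic_mul_exp (inv_pos.2 ha) (1 / (2 * a) + y ^ 2)
    (y / a + y * (2 - 1 / a)) ((2 - 1 / a) / a) (2 * y)).congr (.of_forall fun v => ?_)
  simp only [screeningDensity]
  rw [mul_left_comm, ← Real.exp_add]
  ring_nf

lemma integrableOn_erfc_mul {f : ℝ → ℝ} (hf : Continuous f)
    (hi : Integrable fun v => Real.exp (-2 * v ^ 2) * f v) :
    IntegrableOn (fun v => erfc (√2 * v) * f v) (Set.Ioi 0) := by
  have := continuous_erfc
  refine hi.norm.integrableOn.mono' (by fun_prop) ?_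
  filter_upwards [ae_restrict_mem measurableSet_Ioi] with v hv
  rw [norm_mul, norm_mul, Real.norm_of_nonneg (erfc_nonneg _),
    Real.norm_of_nonneg (Real.exp_pos _).le]
  gcongr
  exact erfc_sqrt_two_mul_le (le_of_lt hv)

lemma integral_erfc_mul_screeningDensity {a : ℝ} (ha : 0 < a) (y : ℝ) :
    ∫ v in Set.Ioi 0, erfc (√2 * v) * screeningDensity a y v =
      √(8 / π) * (∫ v in Set.Ioi 0, Real.exp (-2 * v ^ 2) * screeningPrimitive a y v) - y / 2 := by
  have hd (v : ℝ) : HasDerivAt (fun v => erfc (√2 * v) * screeningPrimitive a y v)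
      (erfc (√2 * v) * screeningDensity a y v -
        √(8 / π) * (Real.exp (-2 * v ^ 2) * screeningPrimitive a y v)) v := by
    refine ((hasDerivAt_erfc_sqrt_two_mul v).mul (hasDerivAt_screeningPrimitive a y v)).congr_deriv
      ?_
    ring
  have iP := integrableOn_erfc_mul (by unfold screeningPrimitive; fun_prop)
    (integrable_exp_mul_screeningPrimitive ha y)
  have iD := integrableOn_erfc_mul (by unfold screeningDensity; fun_prop)
    (integrable_exp_mul_screeningDensity ha y)
  have iE := (integrable_exp_mul_screeningPrimitive ha y).integrableOn (s := Set.Ioi 0)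
    |>.const_mul √(8 / π)
  have h := integral_Ioi_of_hasDerivAt_of_tendsto' (fun v _ => hd v) (iD.sub iE)
    (tendsto_zero_of_hasDerivAt_of_integrableOn_Ioi (fun v _ => hd v) (iD.sub iE) iP)
  rw [integral_sub iD iE, integral_const_mul] at h
  simp only [mul_zero, erfc_zero, screeningPrimitive] at h ⊢
  norm_num at h ⊢
  linarith

lemma integral_exp_mul_screeningPrimitive {a : ℝ} (ha : 0 < a) (y : ℝ) :
    ∫ v, Real.exp (-2 * v ^ 2) * screeningPrimitive a y v =
      √(π * a) * Real.exp (a * y ^ 2) * y := by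
  apply Complex.ofReal_injective
  rw [← integral_complex_ofReal]
  have ha' := inv_pos.2 ha
  have i0 := integrable_mul_cexp_quadratic ha' (2 * y) (p := fun _ => 1) continuous_const
    (fun x => by simp; positivity)
  have i1 := integrable_mul_cexp_quadratic ha' (2 * y) Complex.continuous_ofReal
    norm_ofReal_le_one_add_sq
  simp only [one_mul] at i0
  have hF (v : ℝ) : ((Real.exp (-2 * v ^ 2) * screeningPrimitive a y v : ℝ) : ℂ) =
      1 / (2 * a) * (v * Complex.exp (-(a⁻¹ : ℝ) * v ^ 2 + 2 * y * v)) +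
        y / 2 * Complex.exp (-(a⁻¹ : ℝ) * v ^ 2 + 2 * y * v) := by
    rw [exp_mul_screeningPrimitive]
    push_cast
    ring
  simp_rw [hF]
  rw [integral_add (i1.const_mul _) (i0.const_mul _), integral_const_mul, integral_const_mul,
    integral_mul_cexp_quadratic ha', integral_cexp_neg_mul_sq_add ha', div_inv_eq_mul]
  have hac : (a : ℂ) ≠ 0 := by exact_mod_cast ha.ne'
  have : (2 * y : ℂ) ^ 2 / (4 * (a⁻¹ : ℝ)) = a * y ^ 2 := by
    push_cast
    field_simp
    ring
  rw [this]
  push_cast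
  field_simp
  ring

lemma integral_Ioi_exp_mul_screeningPrimitive_sub {a : ℝ} (ha : 0 < a) (y : ℝ) :
    (∫ v in Set.Ioi 0, Real.exp (-2 * v ^ 2) * screeningPrimitive a y v) -
      (∫ v in Set.Ioi 0, Real.exp (-2 * v ^ 2) * screeningPrimitive a (-y) v) =
      √(π * a) * Real.exp (a * y ^ 2) * y := by
  have i := integrable_exp_mul_screeningPrimitive ha y
  have h := integral_comp_neg_Ioi 0 fun v => Real.exp (-2 * v ^ 2) * screeningPrimitive a y v
  have hneg (v : ℝ) : Real.exp (-2 * (-v) ^ 2) * screeningPrimitive a y (-v) =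
      -(Real.exp (-2 * v ^ 2) * screeningPrimitive a (-y) v) := by
    simp only [screeningPrimitive]
    ring_nf
  simp_rw [hneg, integral_neg, neg_zero] at h
  rw [← integral_exp_mul_screeningPrimitive ha,
    ← intervalIntegral.integral_Iic_add_Ioi i.integrableOn i.integrableOn (b := 0), ← h]
  ring

lemma integral_screeningTerm {a : ℝ} (ha : 0 < a) (ha2 : a < 2) (y : ℝ) :
    ∫ p, screeningTerm a y p ∂(volume.prod (volume.restrict (Set.Ioi 0))) =
      ((√(π / a) * Real.exp (y ^ 2) * (√(8 / π) *
        (∫ v in Set.Ioi 0, Real.exp (-2 * v ^ 2) * screeningPrimitive a y v) - y / 2) : ℝ) : ℂ) := by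
  rw [integral_prod_symm _ (integrable_screeningTerm ha ha2 y)]
  simp_rw [integral_screeningTerm_left ha]
  rw [integral_complex_ofReal, integral_const_mul, integral_erfc_mul_screeningDensity ha]

lemma integral_screeningTerm_sub {a : ℝ} (ha : 0 < a) (ha2 : a < 2) (y : ℝ) :
    ∫ p in {q : ℝ × ℝ | 0 < q.2}, (screeningTerm a y p - screeningTerm a (-y) p) =
      ((√(π / a) * Real.exp (y ^ 2) * y * (√(8 / π) * √(π * a) * Real.exp (a * y ^ 2) - 1) : ℝ) :
        ℂ) := by
  have hs : {q : ℝ × ℝ | 0 < q.2} = Set.univ ×ˢ Set.Ioi 0 := by ext; simp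
  rw [hs, Measure.volume_eq_prod, ← Measure.prod_restrict, Measure.restrict_univ,
    integral_sub (integrable_screeningTerm ha ha2 y) (integrable_screeningTerm ha ha2 (-y)),
    integral_screeningTerm ha ha2, integral_screeningTerm ha ha2, ← Complex.ofReal_sub]
  congr 1
  rw [neg_sq]
  linear_combination √(π / a) * Real.exp (y ^ 2) * √(8 / π) *
    integral_Ioi_exp_mul_screeningPrimitive_sub ha y

/-- The bulk pre-kernel `(v - u) e^{-(u - v)²/2}`, extended to complex arguments. -/
noncomputable def bulkPrekernel (u v : ℂ) : ℂ := (v - u) * Complex.exp (-(u - v) ^ 2 / 2)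

lemma bulkPrekernel_swap (u v : ℂ) : bulkPrekernel v u = -bulkPrekernel u v := by
  rw [bulkPrekernel, bulkPrekernel, ← neg_sub u v, neg_sq]
  ring

open ComplexConjugate in
lemma Ktcc_mul_Ktcc (z w : ℂ) :
    Ktcc z w * Ktcc w z =
      (((erfc (√2 * z.im) * erfc (√2 * w.im) / (2 * π) : ℝ) : ℂ) *
        (bulkPrekernel z w * bulkPrekernel (conj w) (conj z) -
          bulkPrekernel z (conj w) * bulkPrekernel w (conj z))) • 1 := by
  have hc : ((1 / √(2 * π) * √(erfc (√2 * z.im) * erfc (√2 * w.im)) : ℝ) : ℂ) ^ 2 =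
      ((erfc (√2 * z.im) * erfc (√2 * w.im) / (2 * π) : ℝ) : ℂ) := by
    rw [← Complex.ofReal_pow, mul_pow, div_pow, Real.sq_sqrt (by positivity),
      Real.sq_sqrt (mul_nonneg (erfc_nonneg _) (erfc_nonneg _))]
    ring_nf
  have hzw := bulkPrekernel_swap z w
  have hzw' := bulkPrekernel_swap z (conj w)
  have hwz' := bulkPrekernel_swap w (conj z)
  have hcc := bulkPrekernel_swap (conj w) (conj z)
  simp only [Ktcc, Kcc]
  rw [mul_comm (erfc (√2 * w.im)), ← hc]
  simp only [mul_assoc Complex.I, neg_mul, ← bulkPrekernel.eq_1]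
  rw [hzw, hzw', hwz', hcc]
  ext i j
  fin_cases i <;> fin_cases j <;>
    simp [J2, Matrix.mul_apply, Fin.sum_univ_two] <;> ring_nf
  all_goals simp [Complex.I_sq, sub_eq_add_neg]

open ComplexConjugate in
lemma Ktcr_mul_Ktrc (z : ℂ) (x : ℝ) :
    Ktcr z x * Ktrc x z =
      (((erfc (√2 * z.im) / (2 * π) : ℝ) : ℂ) *
        (Complex.I * (conj z - z) * (Complex.exp (-(x - z) ^ 2 / 2) *
          Complex.exp (-(x - conj z) ^ 2 / 2)))) • 1 := by
  have hc : ((1 / √(2 * π) * √(erfc (√2 * z.im)) : ℝ) : ℂ) ^ 2 =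
      ((erfc (√2 * z.im) / (2 * π) : ℝ) : ℂ) := by
    rw [← Complex.ofReal_pow, mul_pow, div_pow, Real.sq_sqrt (by positivity),
      Real.sq_sqrt (erfc_nonneg _)]
    ring_nf
  rw [← hc]
  simp only [Ktcr, Ktrc, Kcr, Krc]
  generalize ((1 / √(2 * π) * √(erfc (√2 * z.im)) : ℝ) : ℂ) = q
  ext i j
  fin_cases i <;> fin_cases j <;>
    simp [J2, Matrix.mul_apply, Fin.sum_univ_two] <;> ring_nf

lemma Ktcc_self (y : ℝ) :
    Ktcc (Complex.I * y) (Complex.I * y) =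
      ((erfc (√2 * y) / √(2 * π) * (2 * y * Real.exp (2 * y ^ 2)) : ℝ) : ℂ) • 1 := by
  have h (u : ℂ) (hu : u ^ 2 = -4 * y ^ 2) : Complex.exp (-u ^ 2 / 2) = Complex.exp (2 * y ^ 2) := by
    rw [hu]; ring_nf
  have h1 : Complex.exp (-(Complex.I * y - -(Complex.I * y)) ^ 2 / 2) =
      Complex.exp (2 * y ^ 2) := h _ (by linear_combination 4 * (y : ℂ) ^ 2 * Complex.I_sq)
  have h2 : Complex.exp (-(-(Complex.I * y) - Complex.I * y) ^ 2 / 2) =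
      Complex.exp (2 * y ^ 2) := h _ (by linear_combination 4 * (y : ℂ) ^ 2 * Complex.I_sq)
  have him : (Complex.I * y).im = y := by simp
  have hconj : (starRingEnd ℂ) (Complex.I * y) = -(Complex.I * y) := by simp
  simp only [Ktcc, Kcc, him, hconj, h1, h2, Real.sqrt_mul_self (erfc_nonneg _)]
  ext i j
  fin_cases i <;> fin_cases j <;>
    simp [J2, Matrix.mul_apply, Fin.sum_univ_two] <;> ring_nf <;> simp [Complex.I_sq]

lemma cexp_smul_Ktcc_mul_Ktcc (a y : ℝ) (p : ℝ × ℝ) :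
    Complex.exp (((1 - a : ℝ) : ℂ) * ((p.1 : ℂ) + (p.2 : ℂ) * Complex.I) ^ 2) •
      (Ktcc (Complex.I * y) ((p.1 : ℂ) + (p.2 : ℂ) * Complex.I) *
        Ktcc ((p.1 : ℂ) + (p.2 : ℂ) * Complex.I) (Complex.I * y)) =
      (((erfc (√2 * y) / (2 * π) : ℝ) : ℂ) * (screeningTerm a y p - screeningTerm a (-y) p)) •
        (1 : Matrix (Fin 2) (Fin 2) ℂ) := by
  obtain ⟨x, v⟩ := p
  have him : (Complex.I * y).im = y := by simp
  have him' : ((x : ℂ) + v * Complex.I).im = v := by simp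
  have hconj : (starRingEnd ℂ) (Complex.I * y) = -(Complex.I * y) := by simp
  have hconj' : (starRingEnd ℂ) ((x : ℂ) + v * Complex.I) = x - v * Complex.I := by
    simp [sub_eq_add_neg]
  rw [Ktcc_mul_Ktcc, smul_smul, him, him', hconj, hconj']
  congr 1
  have key (s : ℝ) : screeningTerm a s (x, v) =
      erfc (√2 * v) * ((x ^ 2 + (v + s) ^ 2) * (Complex.exp ((1 - a) * (x + v * Complex.I) ^ 2) *
        Complex.exp (-x ^ 2 + (v + s) ^ 2))) := by
    rw [screeningTerm, ← Complex.exp_add]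
    push_cast
    ring_nf
  have e1 : bulkPrekernel (Complex.I * y) (x + v * Complex.I) *
      bulkPrekernel (x - v * Complex.I) (-(Complex.I * y)) =
      -((x ^ 2 + (v + (-y : ℝ)) ^ 2) * Complex.exp (-x ^ 2 + (v + (-y : ℝ)) ^ 2)) := by
    rw [bulkPrekernel, bulkPrekernel, mul_mul_mul_comm, ← Complex.exp_add,
      ← neg_mul ((x : ℂ) ^ 2 + _)]
    push_cast
    congr 1
    · linear_combination ((v - y : ℂ) ^ 2) * Complex.I_sq
    · congr 1
      linear_combination -((v - y : ℂ) ^ 2) * Complex.I_sq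
  have e2 : bulkPrekernel (Complex.I * y) (x - v * Complex.I) *
      bulkPrekernel (x + v * Complex.I) (-(Complex.I * y)) =
      -((x ^ 2 + (v + y) ^ 2) * Complex.exp (-x ^ 2 + (v + y) ^ 2)) := by
    rw [bulkPrekernel, bulkPrekernel, mul_mul_mul_comm, ← Complex.exp_add,
      ← neg_mul ((x : ℂ) ^ 2 + _)]
    congr 1
    · linear_combination ((v + y : ℂ) ^ 2) * Complex.I_sq
    · congr 1
      linear_combination -((v + y : ℂ) ^ 2) * Complex.I_sq
  rw [e1, e2, key, key]
  push_cast
  ring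

lemma cexp_smul_Ktcr_mul_Ktrc (a y x : ℝ) :
    Complex.exp (((1 - a : ℝ) : ℂ) * (x : ℂ) ^ 2) •
      (Ktcr (Complex.I * y) x * Ktrc x (Complex.I * y)) =
      ((erfc (√2 * y) / (2 * π) * (2 * y * Real.exp (y ^ 2)) * Real.exp (-a * x ^ 2) : ℝ) : ℂ) •
        (1 : Matrix (Fin 2) (Fin 2) ℂ) := by
  have him : (Complex.I * y).im = y := by simp
  have hconj : (starRingEnd ℂ) (Complex.I * y) = -(Complex.I * y) := by simp
  rw [Ktcr_mul_Ktrc, smul_smul, him, hconj]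
  congr 1
  have e : Complex.exp (((1 - a : ℝ) : ℂ) * (x : ℂ) ^ 2) *
      (Complex.exp (-(x - Complex.I * y) ^ 2 / 2) * Complex.exp (-(x - -(Complex.I * y)) ^ 2 / 2)) =
      Complex.exp (y ^ 2) * Complex.exp (-a * x ^ 2) := by
    rw [← Complex.exp_add, ← Complex.exp_add, ← Complex.exp_add]
    push_cast
    congr 1
    linear_combination -(y : ℂ) ^ 2 * Complex.I_sq
  push_cast at e ⊢
  linear_combination (erfc (√2 * y) / (2 * π) * (Complex.I * (-(Complex.I * y) - Complex.I * y)) : ℂ)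
    * e - (erfc (√2 * y) / (2 * π) * 2 * y * Complex.exp (y ^ 2) * Complex.exp (-a * x ^ 2) : ℂ) *
      Complex.I_sq

theorem stmt_18 (y₀ : ℝ) (hy₀ : 0 ≤ y₀) (α : ℝ) (hα : |α| < 1)
    (z : ℂ) (hz : z = Complex.I * (y₀ : ℂ)) :
    (2 : ℂ) • (∫ p in {q : ℝ × ℝ | 0 < q.2},
        Complex.exp ((α : ℂ) * ((p.1 : ℂ) + (p.2 : ℂ) * Complex.I) ^ 2) •
          (Ktcc z ((p.1 : ℂ) + (p.2 : ℂ) * Complex.I) *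
            Ktcc ((p.1 : ℂ) + (p.2 : ℂ) * Complex.I) z)) +
      (∫ x : ℝ, Complex.exp ((α : ℂ) * (x : ℂ) ^ 2) • (Ktcr z x * Ktrc x z)) =
      (2 : ℂ) • Complex.exp ((α : ℂ) * z ^ 2) • Ktcc z z := by
  subst hz
  obtain ⟨a, rfl⟩ : ∃ a, α = 1 - a := ⟨1 - α, by ring⟩
  obtain ⟨h1, h2⟩ := abs_lt.1 hα
  have ha : 0 < a := by linarith
  have ha2 : a < 2 := by linarith
  simp_rw [cexp_smul_Ktcc_mul_Ktcc, cexp_smul_Ktcr_mul_Ktrc]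
  rw [integral_smul_const, integral_smul_const, integral_const_mul,
    integral_screeningTerm_sub ha ha2, integral_complex_ofReal, integral_const_mul,
    integral_gaussian, Ktcc_self, smul_smul, smul_smul, smul_smul, ← add_smul]
  congr 1
  have he : Complex.exp (((1 - a : ℝ) : ℂ) * (Complex.I * y₀) ^ 2) =
      (Real.exp (-(1 - a) * y₀ ^ 2) : ℝ) := by
    push_cast
    congr 1
    linear_combination (1 - a : ℂ) * y₀ ^ 2 * Complex.I_sq
  rw [he]
  norm_cast
  have hexp : Real.exp (-(1 - a) * y₀ ^ 2) * Real.exp (2 * y₀ ^ 2) =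
      Real.exp (y₀ ^ 2) * Real.exp (a * y₀ ^ 2) := by
    rw [← Real.exp_add, ← Real.exp_add]
    ring_nf
  have hsqrt : √(π / a) * (√(8 / π) * √(π * a)) / π = 4 / √(2 * π) := by
    have hπ := Real.pi_pos
    rw [← Real.sqrt_mul (by positivity), ← Real.sqrt_mul (by positivity),
      show π / a * (8 / π * (π * a)) = 4 ^ 2 * π ^ 2 / (2 * π) by field_simp; norm_num,
      Real.sqrt_div (by positivity), Real.sqrt_mul (by positivity), Real.sqrt_sq (by positivity),
      Real.sqrt_sq (by positivity)]
    field_simp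
  linear_combination erfc (√2 * y₀) * y₀ * Real.exp (y₀ ^ 2) * Real.exp (a * y₀ ^ 2) * hsqrt -
    4 * erfc (√2 * y₀) * y₀ / √(2 * π) * hexp
end

section
/- Let N and s be integers with s ≥ 0 and N − 2 − 2s ≥ 1. Then the integral over all (N−2−2s)×2 real matrices v (with respect to Lebesgue measure on the 2(N−2−2s) independent entries) of det(1₂ + vᵀv)^{−(N−s)} equals π^{N−2s−2} · Γ((N+1)/2)·Γ(N/2+1) / (Γ(N−s−1/2)·Γ(N−s)). -/
open MeasureTheory Real Matrix

theorem lintegral_exp_neg_mul_dotProduct_self {ι : Type*} [Fintype ι] {t : ℝ} (ht : 0 < t) :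
    ∫⁻ x : ι → ℝ, ENNReal.ofReal (exp (-(t * (x ⬝ᵥ x)))) =
      ENNReal.ofReal (√(π / t) ^ Fintype.card ι) := by
  have h (x : ι → ℝ) : exp (-(t * (x ⬝ᵥ x))) = ∏ i, exp (-t * x i ^ 2) := by
    rw [← exp_sum, dotProduct, Finset.mul_sum, ← Finset.sum_neg_distrib]
    exact congrArg exp (Finset.sum_congr rfl fun i _ => by ring)
  have hint : Integrable fun x : ι → ℝ => ∏ i, exp (-t * x i ^ 2) :=
    Integrable.fintype_prod (f := fun _ (y : ℝ) => exp (-t * y ^ 2))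
      fun _ => integrable_exp_neg_mul_sq ht
  simp_rw [h]
  rw [← ofReal_integral_eq_lintegral_ofReal hint
    (Filter.Eventually.of_forall fun x => by positivity),
    integral_fintype_prod_volume_eq_pow fun y : ℝ => exp (-t * y ^ 2), integral_gaussian]

theorem lintegral_rpow_mul_exp_neg_mul_Ioi {a r : ℝ} (ha : 0 < a) (hr : 0 < r) :
    ∫⁻ t in Set.Ioi (0 : ℝ), ENNReal.ofReal (t ^ (a - 1) * exp (-(r * t))) =
      ENNReal.ofReal ((1 / r) ^ a * Gamma a) := by
  have key := integral_rpow_mul_exp_neg_mul_Ioi ha hr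
  have hpos : 0 < (1 / r) ^ a * Gamma a := by
    have := Gamma_pos_of_pos ha
    positivity
  have hint : IntegrableOn (fun t : ℝ => t ^ (a - 1) * exp (-(r * t))) (Set.Ioi 0) :=
    .of_integral_ne_zero (by rw [key]; exact hpos.ne')
  rw [← key, ofReal_integral_eq_lintegral_ofReal hint]
  filter_upwards [ae_restrict_mem measurableSet_Ioi] with t (ht : 0 < t)
  positivity

theorem one_add_dotProduct_self_pos {ι : Type*} [Fintype ι] (x : ι → ℝ) : 0 < 1 + x ⬝ᵥ x := by
  have : 0 ≤ x ⬝ᵥ x := Finset.sum_nonneg fun i _ => mul_self_nonneg (x i)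
  linarith

@[fun_prop]
theorem measurable_dotProduct {ι α : Type*} [Fintype ι] [MeasurableSpace α] {f g : α → ι → ℝ}
    (hf : Measurable f) (hg : Measurable g) : Measurable fun a => f a ⬝ᵥ g a := by
  unfold dotProduct
  fun_prop

/-- The normalisation of the multivariate Cauchy (Student) density. -/
theorem lintegral_one_add_dotProduct_self_rpow_neg {ι : Type*} [Fintype ι] {b : ℝ}
    (hb : (Fintype.card ι : ℝ) / 2 < b) :
    ∫⁻ x : ι → ℝ, ENNReal.ofReal ((1 + x ⬝ᵥ x) ^ (-b)) =
      ENNReal.ofReal (π ^ ((Fintype.card ι : ℝ) / 2) * Gamma (b - (Fintype.card ι : ℝ) / 2) /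
        Gamma b) := by
  set n : ℝ := (Fintype.card ι : ℝ) with hn
  have hb0 : 0 < b := lt_of_le_of_lt (by positivity) hb
  have hΓ : 0 < Gamma b := Gamma_pos_of_pos hb0
  have hc : ENNReal.ofReal (Gamma b) ≠ 0 := by simpa using hΓ
  have key : ENNReal.ofReal (Gamma b) * ∫⁻ x : ι → ℝ, ENNReal.ofReal ((1 + x ⬝ᵥ x) ^ (-b)) =
      ENNReal.ofReal (π ^ (n / 2) * Gamma (b - n / 2)) :=
    calc
      _ = ∫⁻ x : ι → ℝ, ∫⁻ t in Set.Ioi (0 : ℝ),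
          ENNReal.ofReal (t ^ (b - 1) * exp (-((1 + x ⬝ᵥ x) * t))) := by
        rw [← lintegral_const_mul' _ _ ENNReal.ofReal_ne_top]
        refine lintegral_congr fun x => ?_
        have hx := one_add_dotProduct_self_pos x
        rw [lintegral_rpow_mul_exp_neg_mul_Ioi hb0 hx, ← ENNReal.ofReal_mul hΓ.le, one_div,
          inv_rpow hx.le, rpow_neg hx.le, mul_comm]
      _ = ∫⁻ t in Set.Ioi (0 : ℝ), ∫⁻ x : ι → ℝ,
          ENNReal.ofReal (t ^ (b - 1) * exp (-((1 + x ⬝ᵥ x) * t))) := by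
        apply lintegral_lintegral_swap
        apply Measurable.aemeasurable
        simp only [Function.uncurry_def]
        fun_prop
      _ = ∫⁻ t in Set.Ioi (0 : ℝ), ENNReal.ofReal (π ^ (n / 2)) *
          ENNReal.ofReal (t ^ (b - n / 2 - 1) * exp (-(1 * t))) := by
        refine setLIntegral_congr_fun measurableSet_Ioi fun t (ht : 0 < t) => ?_
        have h (x : ι → ℝ) : ENNReal.ofReal (t ^ (b - 1) * exp (-((1 + x ⬝ᵥ x) * t))) =
            ENNReal.ofReal (t ^ (b - 1) * exp (-t)) *
              ENNReal.ofReal (exp (-(t * (x ⬝ᵥ x)))) := by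
          rw [← ENNReal.ofReal_mul (by positivity), mul_assoc, ← exp_add]
          ring_nf
        simp_rw [h]
        rw [lintegral_const_mul' _ _ ENNReal.ofReal_ne_top,
          lintegral_exp_neg_mul_dotProduct_self ht, ← ENNReal.ofReal_mul (by positivity),
          ← ENNReal.ofReal_mul (by positivity)]
        congr 1
        rw [sqrt_eq_rpow, ← rpow_natCast, ← rpow_mul (by positivity), ← hn,
          div_rpow pi_pos.le ht.le, show b - n / 2 - 1 = (b - 1) - 1 / 2 * n by ring,
          rpow_sub ht (b - 1), one_mul, show n / 2 = 1 / 2 * n by ring]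
        ring
      _ = _ := by
        rw [lintegral_const_mul' _ _ ENNReal.ofReal_ne_top,
          lintegral_rpow_mul_exp_neg_mul_Ioi (sub_pos.2 hb) one_pos,
          ← ENNReal.ofReal_mul (by positivity)]
        simp
  rw [ENNReal.ofReal_div_of_pos hΓ, ← key, mul_comm,
    ENNReal.mul_div_cancel_right hc ENNReal.ofReal_ne_top]

/-- Integrating out one of two columns, by the substitution that turns
`(1 + |x|²)(1 + |y|²) - (x ⬝ y)²` into `(1 + |x|²)(1 + |z|²)`. -/
theorem lintegral_gram_rpow_neg {ι : Type*} [Fintype ι] (x : ι → ℝ) (a : ℝ) :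
    ∫⁻ y : ι → ℝ, ENNReal.ofReal (((1 + x ⬝ᵥ x) * (1 + y ⬝ᵥ y) - (x ⬝ᵥ y) ^ 2) ^ (-a)) =
      ENNReal.ofReal ((1 + x ⬝ᵥ x) ^ (-(a - 1 / 2))) *
        ∫⁻ z : ι → ℝ, ENNReal.ofReal ((1 + z ⬝ᵥ z) ^ (-a)) := by
  classical
  have hx := one_add_dotProduct_self_pos x
  set q := √(1 + x ⬝ᵥ x) with hq
  have hq0 : 0 < q := sqrt_pos.2 hx
  have hq2 : q ^ 2 = 1 + x ⬝ᵥ x := sq_sqrt hx.le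
  have hxx : x ⬝ᵥ x = q ^ 2 - 1 := by linarith
  set k := 1 / (q * (q + 1)) with hk
  let M : Matrix ι ι ℝ := 1 + vecMulVec (-k • x) x
  have hdet : M.det = q⁻¹ := by
    simp only [M]
    rw [vecMulVec_eq Unit, det_one_add_replicateCol_mul_replicateRow, dotProduct_smul, hxx, hk, smul_eq_mul]
    field_simp
    ring
  have hM (y : ι → ℝ) : toLin' M y = y - (k * (x ⬝ᵥ y)) • x := by
    ext i
    simp only [M, toLin'_apply, add_mulVec, one_mulVec, vecMulVec_mulVec, op_smul_eq_smul,
      Pi.add_apply, Pi.sub_apply, Pi.smul_apply, smul_eq_mul]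
    ring
  have hgram (y : ι → ℝ) : (1 + x ⬝ᵥ x) * (1 + y ⬝ᵥ y) - (x ⬝ᵥ y) ^ 2 =
      (1 + x ⬝ᵥ x) * (1 + toLin' M y ⬝ᵥ toLin' M y) := by
    simp only [hM, sub_dotProduct, dotProduct_sub, smul_dotProduct, dotProduct_smul, smul_eq_mul,
      dotProduct_comm y x, hxx, hk]
    field_simp
    ring
  have hmap := map_matrix_volume_pi_eq_smul_volume_pi (M := M) (by rw [hdet]; positivity)
  have hmeas : Measurable (toLin' M) := by
    simp_rw [funext hM]
    fun_prop
  have hcv : ∫⁻ y : ι → ℝ, ENNReal.ofReal ((1 + toLin' M y ⬝ᵥ toLin' M y) ^ (-a)) =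
      ENNReal.ofReal q * ∫⁻ z : ι → ℝ, ENNReal.ofReal ((1 + z ⬝ᵥ z) ^ (-a)) := by
    rw [← lintegral_map (f := fun z : ι → ℝ => ENNReal.ofReal ((1 + z ⬝ᵥ z) ^ (-a)))
      (by fun_prop) hmeas, hmap, hdet, inv_inv, abs_of_pos hq0, lintegral_smul_measure, smul_eq_mul]
  have hsplit (y : ι → ℝ) :
      ENNReal.ofReal (((1 + x ⬝ᵥ x) * (1 + y ⬝ᵥ y) - (x ⬝ᵥ y) ^ 2) ^ (-a)) =
        ENNReal.ofReal ((1 + x ⬝ᵥ x) ^ (-a)) *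
          ENNReal.ofReal ((1 + toLin' M y ⬝ᵥ toLin' M y) ^ (-a)) := by
    rw [hgram, mul_rpow hx.le (one_add_dotProduct_self_pos _).le, ENNReal.ofReal_mul (by positivity)]
  simp_rw [hsplit]
  rw [lintegral_const_mul' _ _ ENNReal.ofReal_ne_top, hcv, ← mul_assoc,
    ← ENNReal.ofReal_mul (by positivity), hq, sqrt_eq_rpow, ← rpow_add hx]
  ring_nf

theorem det_one_add_transpose_mul_self {ι : Type*} [Fintype ι] (v : ι → Fin 2 → ℝ) :
    (1 + (Matrix.of v)ᵀ * Matrix.of v).det =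
      (1 + (fun i => v i 0) ⬝ᵥ fun i => v i 0) * (1 + (fun i => v i 1) ⬝ᵥ fun i => v i 1) -
        ((fun i => v i 0) ⬝ᵥ fun i => v i 1) ^ 2 := by
  simp only [det_fin_two, Matrix.add_apply, Matrix.mul_apply, transpose_apply, of_apply,
    dotProduct, one_apply]
  simp only [mul_comm (v _ 1) (v _ 0)]
  simp
  ring

theorem measurePreserving_fin_two_columns (ι : Type*) [Fintype ι] :
    MeasurePreserving fun v : ι → Fin 2 → ℝ => (fun i => v i 0, fun i => v i 1) :=
  (volume_measurePreserving_arrowProdEquivProdArrow ℝ ℝ ι).comp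
    (volume_preserving_pi fun _ : ι => volume_preserving_piFinTwo fun _ => ℝ)

theorem lintegral_det_one_add_transpose_mul_self_rpow_neg {ι : Type*} [Fintype ι] {a : ℝ}
    (ha : (Fintype.card ι : ℝ) / 2 + 1 / 2 < a) :
    ∫⁻ v : ι → Fin 2 → ℝ,
        ENNReal.ofReal ((1 + (Matrix.of v)ᵀ * Matrix.of v).det ^ (-a)) =
      ENNReal.ofReal (π ^ Fintype.card ι *
        (Gamma (a - 1 / 2 - (Fintype.card ι : ℝ) / 2) * Gamma (a - (Fintype.card ι : ℝ) / 2)) /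
          (Gamma (a - 1 / 2) * Gamma a)) := by
  let F : (ι → ℝ) × (ι → ℝ) → ENNReal := fun p => ENNReal.ofReal
    (((1 + p.1 ⬝ᵥ p.1) * (1 + p.2 ⬝ᵥ p.2) - (p.1 ⬝ᵥ p.2) ^ 2) ^ (-a))
  have hF : Measurable F := by
    fun_prop
  have hpos : 0 ≤ π ^ ((Fintype.card ι : ℝ) / 2) *
      Gamma (a - 1 / 2 - (Fintype.card ι : ℝ) / 2) / Gamma (a - 1 / 2) := by
    have h1 : 0 < Gamma (a - 1 / 2 - (Fintype.card ι : ℝ) / 2) := Gamma_pos_of_pos (by linarith)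
    have h2 : 0 < Gamma (a - 1 / 2) :=
      Gamma_pos_of_pos (by linarith [show (0 : ℝ) ≤ Fintype.card ι by positivity])
    positivity
  simp_rw [det_one_add_transpose_mul_self]
  rw [(measurePreserving_fin_two_columns ι).lintegral_comp hF, Measure.volume_eq_prod,
    lintegral_prod _ hF.aemeasurable]
  simp_rw [F, lintegral_gram_rpow_neg]
  rw [lintegral_mul_const _ (by fun_prop),
    lintegral_one_add_dotProduct_self_rpow_neg (by linarith),
    lintegral_one_add_dotProduct_self_rpow_neg (by linarith), ← ENNReal.ofReal_mul hpos]
  congr 1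
  rw [← rpow_natCast, ← add_halves (Fintype.card ι : ℝ), rpow_add pi_pos, add_halves]
  ring

/-- The matrix-variate Cauchy-type integral arising when integrating out the strictly upper
triangular part of the real Schur decomposition of the real spherical ensemble:
`∫ det(1₂ + vᵀv)^{-(N-s)} dv = π^{N-2s-2} Γ((N+1)/2)Γ(N/2+1)/(Γ(N-s-1/2)Γ(N-s))`,
where `v` ranges over `(N-2-2s) × 2` real matrices. -/
theorem stmt_19 (N s : ℕ) (hs : 2 * s + 3 ≤ N) :
    ∫ v : Fin (N - 2 - 2 * s) → Fin 2 → ℝ,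
        ((1 + (Matrix.of v)ᵀ * Matrix.of v).det) ^ (-((N : ℤ) - (s : ℤ))) =
      π ^ (N - 2 * s - 2) * Gamma (((N : ℝ) + 1) / 2) * Gamma ((N : ℝ) / 2 + 1) /
        (Gamma ((N : ℝ) - s - 1 / 2) * Gamma ((N : ℝ) - s)) := by
  have hcard : ((N - 2 - 2 * s : ℕ) : ℝ) = N - 2 - 2 * s := by
    rw [Nat.cast_sub (by omega), Nat.cast_sub (by omega)]
    push_cast
    ring
  have hsN : 2 * (s : ℝ) + 3 ≤ N := by exact_mod_cast hs
  have hs0 : (0 : ℝ) ≤ s := by positivity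
  have hpow (v : Fin (N - 2 - 2 * s) → Fin 2 → ℝ) :
      ((1 + (Matrix.of v)ᵀ * Matrix.of v).det) ^ (-((N : ℤ) - (s : ℤ))) =
        (1 + (Matrix.of v)ᵀ * Matrix.of v).det ^ (-((N : ℝ) - s)) := by
    rw [← rpow_intCast]
    push_cast
    rfl
  have hdet (v : Fin (N - 2 - 2 * s) → Fin 2 → ℝ) :
      0 ≤ (1 + (Matrix.of v)ᵀ * Matrix.of v).det := by
    have : (1 + (Matrix.of v)ᵀ * Matrix.of v).PosSemidef :=
      PosSemidef.one.add (posSemidef_conjTranspose_mul_self (Matrix.of v))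
    exact this.det_nonneg
  simp_rw [hpow]
  rw [integral_eq_lintegral_of_nonneg_ae
    (Filter.Eventually.of_forall fun v => rpow_nonneg (hdet v) _) ?_,
    lintegral_det_one_add_transpose_mul_self_rpow_neg (by
      rw [Fintype.card_fin, hcard]; linarith), Fintype.card_fin, hcard, ENNReal.toReal_ofReal]
  · rw [show N - 2 - 2 * s = N - 2 * s - 2 by omega]
    ring_nf
  · have h1 : 0 < Gamma ((N : ℝ) - s - 1 / 2 - (N - 2 - 2 * s) / 2) :=
      Gamma_pos_of_pos (by linarith)
    have h2 : 0 < Gamma ((N : ℝ) - s - (N - 2 - 2 * s) / 2) := Gamma_pos_of_pos (by linarith)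
    have h3 : 0 < Gamma ((N : ℝ) - s - 1 / 2) := Gamma_pos_of_pos (by linarith)
    have h4 : 0 < Gamma ((N : ℝ) - s) := Gamma_pos_of_pos (by linarith)
    positivity
  · simp_rw [det_one_add_transpose_mul_self]
    apply Measurable.aestronglyMeasurable
    fun_prop
end
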